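/- Let Ω ⊂ ℂ be a bounded simply connected domain whose boundary is a Jordan curve that is locally the graph of a Lipschitz function, let 1 ≤ p < ∞, and suppose h ∈ h^p(bΩ) and H ∈ h^p_-(bΩ) satisfy h = H a.e. on bΩ with respect to arc length. Then h = 0 a.e. on bΩ and H = 0 a.e. on bΩ; equivalently, the holomorphic function on Ω with boundary values h and the holomorphic function on ℂ ∖ Ω̄ with boundary values H are both identically zero. -/

import Mathlib

open Complex MeasureTheory Metric Set Filter
open scoped ENNReal NNReal Topology

noncomputable section

/-- Arc-length measure on the boundary of `Ω`: one-dimensional Hausdorff measure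
restricted to the boundary. -/
def bMeasure (Ω : Set ℂ) : Measure ℂ := (μH[1]).restrict (frontier Ω)

/-- Nontangential approach region inside `S` with vertex `q`, boundary set `B`
and aperture `κ`. -/
def ntCone (S B : Set ℂ) (κ : ℝ) (q : ℂ) : Set ℂ :=
  {z ∈ S | dist z q < κ * infDist z B}

/-- `u` is the almost everywhere nontangential boundary value function of `f`
(with aperture `κ`), with respect to arc length on `B`. -/
def NTBdryValue (S B : Set ℂ) (κ : ℝ) (f u : ℂ → ℂ) : Prop :=
  ∀ᵐ q ∂((μH[1]).restrict B), Tendsto f (𝓝[ntCone S B κ q] q) (𝓝 (u q))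

/-- The nontangential maximal function of `f` with aperture `κ`. -/
def ntMax (S B : Set ℂ) (κ : ℝ) (f : ℂ → ℂ) (q : ℂ) : ℝ≥0∞ :=
  ⨆ z ∈ ntCone S B κ q, (‖f z‖₊ : ℝ≥0∞)

/-- The nontangential maximal function of `f` lies in `L^p` of arc-length measure on `B`. -/
def MaximalInLp (S B : Set ℂ) (κ : ℝ) (p : ℝ) (f : ℂ → ℂ) : Prop :=
  ∫⁻ q, (ntMax S B κ f q) ^ p ∂((μH[1]).restrict B) < ⊤

/-- `u` belongs to the boundary Hardy space `h^p(bΩ)`: it is the a.e. nontangential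
boundary value function of a holomorphic function on `Ω` whose interior nontangential
maximal function lies in `L^p` of arc-length measure. -/
def MemHp (Ω : Set ℂ) (p : ℝ) (u : ℂ → ℂ) : Prop :=
  ∃ f : ℂ → ℂ, DifferentiableOn ℂ f Ω ∧ ∃ κ > 1,
    MaximalInLp Ω (frontier Ω) κ p f ∧ NTBdryValue Ω (frontier Ω) κ f u

/-- `u` belongs to the exterior boundary Hardy space `h^p_-(bΩ)`: it is the a.e.
nontangential boundary value function of a holomorphic function on `ℂ ∖ Ω̄` that
vanishes at infinity and whose exterior nontangential maximal function lies in `L^p`. -/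
def MemHpExt (Ω : Set ℂ) (p : ℝ) (u : ℂ → ℂ) : Prop :=
  ∃ f : ℂ → ℂ, DifferentiableOn ℂ f (closure Ω)ᶜ ∧
    Tendsto f (cocompact ℂ) (𝓝 0) ∧ ∃ κ > 1,
    MaximalInLp ((closure Ω)ᶜ) (frontier Ω) κ p f ∧
    NTBdryValue ((closure Ω)ᶜ) (frontier Ω) κ f u

/-- `Ω` is a bounded simply connected Jordan domain whose boundary is the Jordan curve
parametrized (counterclockwise, in a bi-Lipschitz fashion) by `γ` on `[0,1]`, and the
boundary is locally the graph of a Lipschitz function. -/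
structure LipschitzJordanDomain (Ω : Set ℂ) (γ : ℝ → ℂ) : Prop where
  isOpen : IsOpen Ω
  bounded : Bornology.IsBounded Ω
  nonempty : Ω.Nonempty
  simplyConnected : SimplyConnectedSpace Ω
  closedCurve : γ 0 = γ 1
  injOn : InjOn γ (Ico 0 1)
  image : γ '' (Icc 0 1) = frontier Ω
  lipschitz : ∃ K : ℝ≥0, LipschitzOnWith K γ (Icc 0 1)
  biLip : ∃ c > 0, ∀ s ∈ Icc (0:ℝ) 1, ∀ t ∈ Icc (0:ℝ) 1,
      c * min |s - t| (1 - |s - t|) ≤ dist (γ s) (γ t)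
  orientation : ∀ z ∈ Ω,
      (2 * Real.pi * I)⁻¹ * ∫ t in (0:ℝ)..1, deriv γ t / (γ t - z) = 1
  lipGraph : ∀ q ∈ frontier Ω, ∃ θ : ℝ, ∃ φ : ℝ → ℝ, ∃ K : ℝ≥0, ∃ R ∈ 𝓝 q,
      LipschitzWith K φ ∧
      R ∩ Ω = R ∩ {z : ℂ | φ ((Complex.exp (-(θ:ℂ) * I) * z).re)
        < (Complex.exp (-(θ:ℂ) * I) * z).im}

/-- The Cauchy integral of `u` over the boundary curve `γ`. -/
def cauchyIntegral (γ : ℝ → ℂ) (u : ℂ → ℂ) (z : ℂ) : ℂ :=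
  (2 * Real.pi * I)⁻¹ * ∫ t in (0:ℝ)..1, u (γ t) * deriv γ t / (γ t - z)

open scoped Convolution

/-- Twice the Cauchy-Riemann operator. -/
def DD (u : ℂ → ℂ) (z : ℂ) : ℂ := fderiv ℝ u z 1 + I * fderiv ℝ u z I

lemma DD_mul {u v : ℂ → ℂ} {z : ℂ} (hu : DifferentiableAt ℝ u z) (hv : DifferentiableAt ℝ v z) :
    DD (fun z => u z * v z) z = u z * DD v z + v z * DD u z := by
  unfold DD
  rw [fderiv_fun_mul hu hv]
  simp
  ring

lemma DD_holo {u : ℂ → ℂ} {z : ℂ} (hu : DifferentiableAt ℂ u z) : DD u z = 0 := by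
  unfold DD
  rw [hu.fderiv_restrictScalars ℝ]
  have : fderiv ℂ u z I = I * fderiv ℂ u z 1 := by
    have := (fderiv ℂ u z).map_smul I 1
    simpa using this
  simp only [ContinuousLinearMap.coe_restrictScalars']
  rw [this, ← mul_assoc, I_mul_I]
  ring

lemma DD_congr {u v : ℂ → ℂ} {z : ℂ} (h : u =ᶠ[𝓝 z] v) : DD u z = DD v z := by
  unfold DD
  rw [h.fderiv_eq]

lemma DD_const {z c : ℂ} : DD (fun _ => c) z = 0 := by
  unfold DD
  simp

lemma continuous_DD {u : ℂ → ℂ} (hu : ContDiff ℝ 1 u) : Continuous (DD u) := by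
  unfold DD
  have := hu.continuous_fderiv (by norm_num)
  fun_prop

lemma hasCompactSupport_DD {u : ℂ → ℂ} (hu : HasCompactSupport u) : HasCompactSupport (DD u) := by
  refine HasCompactSupport.mono (hu.fderiv (𝕜 := ℝ)) ?_
  intro z hz
  contrapose! hz
  simp only [Function.mem_support, not_not] at hz ⊢
  simp [DD, hz]

lemma norm_DD_le {u : ℂ → ℂ} {C : ℝ≥0} (hu : LipschitzWith C u) (z : ℂ) : ‖DD u z‖ ≤ 2 * C := by
  unfold DD
  have h := norm_fderiv_le_of_lipschitz ℝ hu (x₀ := z)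
  have h1 := (fderiv ℝ u z).le_of_opNorm_le h 1
  have h2 := (fderiv ℝ u z).le_of_opNorm_le h I
  simp at h1 h2
  calc _ ≤ _ := norm_add_le _ _
    _ ≤ _ := by simp; linarith

lemma integral_fderiv_zero {u : ℂ → ℂ} (hu : ContDiff ℝ 1 u) (hc : HasCompactSupport u) (v : ℂ) :
    ∫ z, fderiv ℝ u z v = 0 := by
  have hcont := hu.continuous_fderiv (by norm_num)
  have h1 : Integrable (fun z => fderiv ℝ u z v) := by
    apply Continuous.integrable_of_hasCompactSupport (by fun_prop)
    refine HasCompactSupport.mono (hc.fderiv (𝕜 := ℝ)) ?_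
    intro z hz
    contrapose! hz
    simp only [Function.mem_support, not_not] at hz ⊢
    simp [hz]
  have h2 : Integrable u := hu.continuous.integrable_of_hasCompactSupport hc
  have := integral_bilinear_hasLineDerivAt_right_eq_neg_left_of_integrable
    (μ := (volume : Measure ℂ)) (f := fun _ : ℂ => (1:ℝ)) (f' := fun _ => 0) (g := u)
    (g' := fun z => fderiv ℝ u z v) (v := v) (B := ContinuousLinearMap.lsmul ℝ ℝ)
    (by simp) (by simpa using h1) (by simpa using h2)
    (fun x _ => by simpa using (hasFDerivAt_const (1:ℝ) x).hasLineDerivAt v)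
    (fun x _ => ((hu.differentiable (by norm_num)) x).hasFDerivAt.hasLineDerivAt v)
  simpa using this

lemma integral_DD {u : ℂ → ℂ} (hu : ContDiff ℝ 1 u) (hc : HasCompactSupport u) :
    ∫ z, DD u z = 0 := by
  have hcont := hu.continuous_fderiv (by norm_num)
  have h1 (v : ℂ) : Integrable (fun z => fderiv ℝ u z v) := by
    apply Continuous.integrable_of_hasCompactSupport (by fun_prop)
    refine HasCompactSupport.mono (hc.fderiv (𝕜 := ℝ)) ?_
    intro z hz
    contrapose! hz
    simp only [Function.mem_support, not_not] at hz ⊢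
    simp [hz]
  unfold DD
  rw [integral_add (h1 1) ((h1 I).const_mul I), integral_const_mul, integral_fderiv_zero hu hc,
    integral_fderiv_zero hu hc]
  simp

lemma exists_cutoff (B : Set ℂ) {ε : ℝ} (hε : 0 < ε) :
    ∃ χ : ℂ → ℂ, ContDiff ℝ 1 χ ∧ (∀ z, infDist z B ≤ ε / 4 → χ z = 0) ∧
      (∀ z, ε ≤ infDist z B → χ z = 1) ∧ (∀ z, ‖1 - χ z‖ ≤ 2) ∧
      LipschitzWith (Real.toNNReal (4 / ε)) χ := by
  let k : ℝ → ℝ := fun t => min 1 (max 0 (4 / ε * (t - ε / 2)))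
  have hk01 : ∀ t, 0 ≤ k t ∧ k t ≤ 1 := fun t => ⟨by simp [k], by simp [k]⟩
  let g : ℂ → ℂ := fun z => (k (infDist z B) : ℂ)
  have hgL : LipschitzWith (Real.toNNReal (4 / ε)) g := by
    apply LipschitzWith.of_dist_le_mul
    intro x y
    rw [Real.coe_toNNReal _ (by positivity)]
    have h1 : dist (g x) (g y) = |k (infDist x B) - k (infDist y B)| := by
      simp only [g, dist_eq, ← ofReal_sub, norm_real, Real.norm_eq_abs]
    have h2 : |infDist x B - infDist y B| ≤ dist x y := by
      have := (lipschitz_infDist_pt B).dist_le_mul x y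
      simpa [Real.dist_eq] using this
    rw [h1]
    calc _ ≤ |4 / ε * (infDist x B - ε / 2) - 4 / ε * (infDist y B - ε / 2)| := by
          simp only [k]
          refine (abs_min_sub_min_le_max _ _ _ _).trans ?_
          simp only [sub_self, abs_zero]
          refine max_le (abs_nonneg _) ?_
          refine (abs_max_sub_max_le_max _ _ _ _).trans ?_
          simp
      _ = 4 / ε * |infDist x B - infDist y B| := by
          rw [← mul_sub, abs_mul, abs_of_pos (by positivity)]
          congr 2; ring
      _ ≤ _ := by gcongr
  let ρ : ContDiffBump (0 : ℂ) := ⟨ε / 8, ε / 4, by positivity, by linarith⟩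
  have hloc : LocallyIntegrable g := hgL.continuous.locallyIntegrable
  have hnear : ∀ z x : ℂ, x ∈ ball z ρ.rOut → |infDist x B - infDist z B| < ε / 4 := by
    intro z x hx
    have := (lipschitz_infDist_pt B).dist_le_mul x z
    simp [Real.dist_eq] at this
    have h3 : dist x z < ε / 4 := hx
    linarith
  refine ⟨(ρ.normed volume ⋆[ContinuousLinearMap.lsmul ℝ ℝ, volume] g), ?_, ?_, ?_, ?_, ?_⟩
  · exact ρ.hasCompactSupport_normed.contDiff_convolution_left _ ρ.contDiff_normed hloc
  · intro z hz
    have h0 : ∀ x ∈ ball z ρ.rOut, g x = 0 := by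
      intro x hx
      have := abs_lt.1 (hnear z x hx)
      have h4 : 4 / ε * (infDist x B - ε / 2) ≤ 0 :=
        mul_nonpos_of_nonneg_of_nonpos (by positivity) (by linarith)
      simp [g, k, max_eq_left h4]
    have hz0 := h0 z (mem_ball_self ρ.rOut_pos)
    rw [ρ.normed_convolution_eq_right (fun x hx => by rw [h0 x hx, hz0]), hz0]
  · intro z hz
    have h0 : ∀ x ∈ ball z ρ.rOut, g x = 1 := by
      intro x hx
      have := abs_lt.1 (hnear z x hx)
      have h4 : 1 ≤ 4 / ε * (infDist x B - ε / 2) := by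
        rw [div_mul_eq_mul_div, le_div_iff₀ hε]; linarith
      have : max 0 (4 / ε * (infDist x B - ε / 2)) ≥ 1 := le_max_of_le_right h4
      simp [g, k, min_eq_left this]
    have hz0 := h0 z (mem_ball_self ρ.rOut_pos)
    rw [ρ.normed_convolution_eq_right (fun x hx => by rw [h0 x hx, hz0]), hz0]
  · intro z
    have h1 : dist ((ρ.normed volume ⋆[ContinuousLinearMap.lsmul ℝ ℝ, volume] g : ℂ → ℂ) z)
        (g z) ≤ 1 := by
      apply ρ.dist_normed_convolution_le hgL.continuous.aestronglyMeasurable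
      intro x _
      simp only [g, dist_eq, ← ofReal_sub, norm_real, Real.norm_eq_abs]
      rw [abs_le]
      constructor <;> linarith [hk01 (infDist x B), hk01 (infDist z B)]
    have h2 : ‖1 - g z‖ ≤ 1 := by
      simp only [g, ← ofReal_sub, ← ofReal_one, norm_real, Real.norm_eq_abs]
      rw [abs_le]
      constructor <;> linarith [hk01 (infDist z B)]
    rw [dist_comm, dist_eq] at h1
    calc _ = ‖(1 - g z) + (g z - (ρ.normed volume ⋆[ContinuousLinearMap.lsmul ℝ ℝ, volume] g : ℂ → ℂ) z)‖ := by
          congr 1; ring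
      _ ≤ _ := norm_add_le _ _
      _ ≤ 2 := by linarith
  · apply LipschitzWith.of_dist_le_mul
    intro x y
    rw [dist_eq, convolution_def, convolution_def]
    have hi : ∀ x : ℂ, Integrable (fun t => ContinuousLinearMap.lsmul ℝ ℝ (ρ.normed volume t) (g (x - t))) := by
      intro x
      apply Continuous.integrable_of_hasCompactSupport
      · have := hgL.continuous
        have := ρ.continuous_normed (μ := volume)
        simp only [ContinuousLinearMap.lsmul_apply]
        fun_prop
      · refine HasCompactSupport.mono (ρ.hasCompactSupport_normed (μ := volume)) ?_
        intro z hz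
        contrapose! hz
        simp only [Function.mem_support, not_not] at hz ⊢
        simp [hz]
    rw [← integral_sub (hi x) (hi y)]
    calc _ ≤ ∫ t, ρ.normed volume t * ((Real.toNNReal (4 / ε)) * dist x y) := by
          apply norm_integral_le_of_norm_le
          · exact ρ.integrable_normed.mul_const _
          · refine Eventually.of_forall fun t => ?_
            simp only [ContinuousLinearMap.lsmul_apply]
            rw [← smul_sub, norm_smul, Real.norm_eq_abs, abs_of_nonneg (ρ.nonneg_normed t)]
            gcongr
            · exact ρ.nonneg_normed t
            · have := hgL.dist_le_mul (x - t) (y - t)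
              rw [dist_sub_right] at this
              rwa [← dist_eq]
      _ = _ := by rw [integral_mul_const, ρ.integral_normed, one_mul]

lemma lsc_sup {α : Type*} [CompleteLinearOrder α] (S : ℂ → Set ℂ)
    (hS : ∀ z, IsOpen {q | z ∈ S q}) (w : ℂ → α) :
    LowerSemicontinuous (fun q => ⨆ z ∈ S q, w z) := by
  rw [lowerSemicontinuous_iff_isOpen_preimage]
  intro a
  have : (fun q => ⨆ z ∈ S q, w z) ⁻¹' Ioi a = ⋃ z ∈ {z | a < w z}, {q | z ∈ S q} := by
    ext q
    simp only [mem_preimage, mem_Ioi, lt_iSup_iff, mem_iUnion, mem_ofPred_eq, exists_prop]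
    constructor
    · rintro ⟨z, h1, h2⟩; exact ⟨z, h2, h1⟩
    · rintro ⟨z, h1, h2⟩; exact ⟨z, h2, h1⟩
  rw [this]
  exact isOpen_biUnion fun z _ => hS z

/-- Two-sided nontangential region. -/
def tcone (B : Set ℂ) (κ δ : ℝ) (q : ℂ) : Set ℂ :=
  {z | dist z q < κ * infDist z B ∧ dist z q < δ}

lemma isOpen_tcone' (B : Set ℂ) (κ δ : ℝ) (z : ℂ) : IsOpen {q | z ∈ tcone B κ δ q} := by
  unfold tcone
  simp only [mem_ofPred_eq]
  have h1 : IsOpen {q : ℂ | dist z q < κ * infDist z B} := isOpen_lt (by fun_prop) (by fun_prop)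
  have h2 : IsOpen {q : ℂ | dist z q < δ} := isOpen_lt (by fun_prop) (by fun_prop)
  exact h1.inter h2

/-- Truncated nontangential maximal function. -/
def NN (B : Set ℂ) (κ δ : ℝ) (w : ℂ → ℝ≥0∞) (q : ℂ) : ℝ≥0∞ := ⨆ z ∈ tcone B κ δ q, w z

lemma measurable_NN (B : Set ℂ) (κ δ : ℝ) (w : ℂ → ℝ≥0∞) : Measurable (NN B κ δ w) :=
  (lsc_sup _ (isOpen_tcone' B κ δ) w).measurable

lemma band_ineq (B : Set ℂ) (hB : IsCompact B) (hBne : B.Nonempty) (σ : Measure ℂ)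
    [IsFiniteMeasure σ] {c r0 κ ε : ℝ} (hc : 0 < c) (hκ : 1 < κ) (hε : 0 < ε)
    (hlow : ∀ q ∈ B, ∀ r, 0 < r → r ≤ r0 → ENNReal.ofReal (c * r) ≤ σ (ball q r))
    (hr : (κ - 1) * ε ≤ r0) (w : ℂ → ℝ≥0∞) :
    ENNReal.ofReal (1 / ε) * ∫⁻ z in {z | ε / 4 ≤ infDist z B ∧ infDist z B ≤ ε}, w z ≤
      ENNReal.ofReal (4 * κ ^ 2 * Real.pi / (c * (κ - 1))) * ∫⁻ q, NN B κ (κ * ε) w q ∂σ := by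
  have hκ1 : 0 < κ - 1 := by linarith
  set a := c * ((κ - 1) * (ε / 4)) with ha
  have hapos : 0 < a := by positivity
  have hN := measurable_NN B κ (κ * ε) w
  have hband : MeasurableSet {z : ℂ | ε / 4 ≤ infDist z B ∧ infDist z B ≤ ε} := by
    apply MeasurableSet.inter
    · exact (isClosed_le (by fun_prop) (continuous_infDist_pt B)).measurableSet
    · exact (isClosed_le (continuous_infDist_pt B) (by fun_prop)).measurableSet
  let ind : ℂ → ℂ → ℝ≥0∞ := fun z q => (ball q (κ * ε)).indicator 1 z
  have hpt : ∀ z ∈ {z : ℂ | ε / 4 ≤ infDist z B ∧ infDist z B ≤ ε},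
      w z * ENNReal.ofReal a ≤ ∫⁻ q, ind z q * NN B κ (κ * ε) w q ∂σ := by
    rintro z ⟨hz1, hz2⟩
    obtain ⟨q0, hq0, hd⟩ := hB.exists_infDist_eq_dist hBne z
    set d := infDist z B with hdd
    have hd0 : 0 < d := by linarith
    have hT : ∀ q ∈ ball q0 ((κ - 1) * d), dist z q < κ * d := by
      intro q hq
      have := dist_triangle z q0 q
      rw [mem_ball, dist_comm] at hq
      nlinarith
    calc w z * ENNReal.ofReal a ≤ w z * σ (ball q0 ((κ - 1) * d)) := by
          gcongr
          refine le_trans ?_ (hlow q0 hq0 _ (by positivity) (le_trans ?_ hr))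
          · apply ENNReal.ofReal_le_ofReal; rw [ha]; gcongr
          · gcongr
      _ = ∫⁻ q in ball q0 ((κ - 1) * d), w z ∂σ := by
          rw [setLIntegral_const]
      _ ≤ ∫⁻ q in ball q0 ((κ - 1) * d), ind z q * NN B κ (κ * ε) w q ∂σ := by
          refine setLIntegral_mono' measurableSet_ball fun q hq => ?_
          have h1 := hT q hq
          have h2 : dist z q < κ * ε := h1.trans_le (by gcongr)
          have h3 : ind z q = 1 := by
            simp only [ind]
            rw [indicator_of_mem (by simpa using h2)]; rfl
          rw [h3, one_mul]
          exact le_iSup₂ (f := fun z _ => w z) z ⟨h1, h2⟩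
      _ ≤ _ := setLIntegral_le_lintegral _ _
  have hmeas : Measurable (Function.uncurry fun z q => ind z q * NN B κ (κ * ε) w q) := by
    apply Measurable.mul
    · have : (Function.uncurry ind) = ({p : ℂ × ℂ | dist p.1 p.2 < κ * ε}).indicator 1 := by
        ext ⟨z, q⟩
        simp [Function.uncurry, ind, indicator]
      change Measurable (Function.uncurry ind)
      rw [this]
      exact measurable_one.indicator (isOpen_lt (by fun_prop) (by fun_prop)).measurableSet
    · exact hN.comp measurable_snd
  have key : (∫⁻ z in {z : ℂ | ε / 4 ≤ infDist z B ∧ infDist z B ≤ ε}, w z) * ENNReal.ofReal a ≤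
      ENNReal.ofReal (κ ^ 2 * ε ^ 2 * Real.pi) * ∫⁻ q, NN B κ (κ * ε) w q ∂σ := by
    calc _ = ∫⁻ z in {z : ℂ | ε / 4 ≤ infDist z B ∧ infDist z B ≤ ε}, w z * ENNReal.ofReal a := by
          rw [lintegral_mul_const' _ _ ENNReal.ofReal_ne_top]
      _ ≤ ∫⁻ z in {z : ℂ | ε / 4 ≤ infDist z B ∧ infDist z B ≤ ε},
            ∫⁻ q, ind z q * NN B κ (κ * ε) w q ∂σ := setLIntegral_mono' hband hpt
      _ ≤ ∫⁻ z, ∫⁻ q, ind z q * NN B κ (κ * ε) w q ∂σ := setLIntegral_le_lintegral _ _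
      _ = ∫⁻ q, ∫⁻ z, ind z q * NN B κ (κ * ε) w q ∂volume ∂σ :=
          lintegral_lintegral_swap hmeas.aemeasurable
      _ = ∫⁻ q, ENNReal.ofReal (κ ^ 2 * ε ^ 2 * Real.pi) * NN B κ (κ * ε) w q ∂σ := by
          congr 1
          ext q
          rw [lintegral_mul_const]
          · congr 1
            simp only [ind]
            rw [lintegral_indicator_one measurableSet_ball, Complex.volume_ball,
              ← ENNReal.ofReal_pow (by positivity), ← ENNReal.ofReal_coe_nnreal,
              ← ENNReal.ofReal_mul (by positivity), NNReal.coe_real_pi]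
            congr 1; ring
          · exact measurable_one.indicator measurableSet_ball
      _ = _ := lintegral_const_mul _ hN
  calc _ = ENNReal.ofReal (1 / (a * ε)) * ((∫⁻ z in {z : ℂ | ε / 4 ≤ infDist z B ∧ infDist z B ≤ ε}, w z) * ENNReal.ofReal a) := by
        rw [mul_comm (lintegral _ _), ← mul_assoc, ← ENNReal.ofReal_mul (by positivity)]
        congr 2
        field_simp
    _ ≤ ENNReal.ofReal (1 / (a * ε)) * (ENNReal.ofReal (κ ^ 2 * ε ^ 2 * Real.pi) * ∫⁻ q, NN B κ (κ * ε) w q ∂σ) := by gcongr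
    _ = _ := by
        rw [← mul_assoc, ← ENNReal.ofReal_mul (by positivity)]
        congr 2
        rw [ha]
        field_simp

lemma integrable_off (B : Set ℂ) (hB : IsClosed B) {F ψ : ℂ → ℂ} (hF : ContinuousOn F Bᶜ)
    (hψ : Continuous ψ) (hψc : HasCompactSupport ψ) {η : ℝ} (hη : 0 < η)
    (h0 : ∀ z, infDist z B < η → ψ z = 0) : Integrable (fun z => F z * ψ z) := by
  apply Continuous.integrable_of_hasCompactSupport
  · rw [continuous_iff_continuousAt]
    intro z
    by_cases hz : infDist z B < η
    · have : (fun z => F z * ψ z) =ᶠ[𝓝 z] fun _ => 0 := by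
        filter_upwards [(isOpen_lt (continuous_infDist_pt B) continuous_const).mem_nhds hz] with x hx
        rw [h0 x hx, mul_zero]
      exact continuousAt_const.congr this.symm
    · have hzB : z ∈ Bᶜ := by
        intro hzB
        rw [infDist_zero_of_mem hzB] at hz
        exact hz hη
      exact (hF.continuousAt (hB.isOpen_compl.mem_nhds hzB)).mul hψ.continuousAt
  · exact hψc.mul_left

lemma step_ineq (B : Set ℂ) (hB : IsCompact B) (hBne : B.Nonempty) (σ : Measure ℂ)
    [IsFiniteMeasure σ] {c r0 κ ε ε1 : ℝ} (hc : 0 < c) (hκ : 1 < κ) (hε : 0 < ε)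
    (hlow : ∀ q ∈ B, ∀ r, 0 < r → r ≤ r0 → ENNReal.ofReal (c * r) ≤ σ (ball q r))
    (hr : (κ - 1) * ε ≤ r0) (hε1 : ε < ε1) {F φ u : ℂ → ℂ} (hF : DifferentiableOn ℂ F Bᶜ)
    (hφ : ContDiff ℝ 1 φ) (hφc : HasCompactSupport φ) (hφ1 : ∀ z, infDist z B < ε1 → φ z = 1)
    (hu : ContDiff ℝ 1 u) (huc : HasCompactSupport u) {M : ℝ} (hM : ∀ z, ‖DD u z‖ ≤ M) :
    ‖∫ z, F z * DD φ z‖ₑ ≤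
      ENNReal.ofReal 8 * (ENNReal.ofReal (4 * κ ^ 2 * Real.pi / (c * (κ - 1))) *
        ∫⁻ q, NN B κ (κ * ε) (fun z => ‖F z - u z‖ₑ) q ∂σ) +
      ENNReal.ofReal (2 * M) * volume (cthickening ε B) := by
  obtain ⟨χ, hχ, hχ0, hχ1, hχ2, hχL⟩ := exists_cutoff B hε
  have hM0 : 0 ≤ M := (norm_nonneg _).trans (hM 0)
  have hcd := continuous_infDist_pt B
  have hcth : cthickening ε B = {z | infDist z B ≤ ε} := by
    ext z
    rw [mem_cthickening_iff, ENNReal.le_ofReal_iff_toReal_le (infEDist_ne_top hBne) hε.le]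
    rfl
  have hclosed := hB.isClosed
  -- locality facts
  have nearlt : ∀ z r, infDist z B < r → ∀ᶠ x in 𝓝 z, infDist x B < r := fun z r h =>
    (isOpen_lt hcd continuous_const).mem_nhds h
  have neargt : ∀ z r, r < infDist z B → ∀ᶠ x in 𝓝 z, r < infDist x B := fun z r h =>
    (isOpen_lt continuous_const hcd).mem_nhds h
  have eχ0 : ∀ z, infDist z B < ε / 4 → χ =ᶠ[𝓝 z] fun _ => 0 := fun z hz => by
    filter_upwards [nearlt z _ hz] with x hx using hχ0 x hx.le
  have eχ1 : ∀ z, ε < infDist z B → χ =ᶠ[𝓝 z] fun _ => 1 := fun z hz => by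
    filter_upwards [neargt z _ hz] with x hx using hχ1 x hx.le
  have eφ1 : ∀ z, infDist z B < ε1 → φ =ᶠ[𝓝 z] fun _ => 1 := fun z hz => by
    filter_upwards [nearlt z _ hz] with x hx using hφ1 x hx
  have dχ0 : ∀ z, infDist z B < ε / 4 → DD χ z = 0 := fun z hz => by
    rw [DD_congr (eχ0 z hz), DD_const]
  have dχ1 : ∀ z, ε < infDist z B → DD χ z = 0 := fun z hz => by
    rw [DD_congr (eχ1 z hz), DD_const]
  have dφ1 : ∀ z, infDist z B < ε1 → DD φ z = 0 := fun z hz => by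
    rw [DD_congr (eφ1 z hz), DD_const]
  have dχc : HasCompactSupport (DD χ) := by
    refine HasCompactSupport.of_support_subset_isCompact (hB.cthickening (r := ε)) ?_
    intro z hz
    rw [hcth]
    by_contra hcon
    exact hz (dχ1 z (by simpa using hcon))
  have hFd : ∀ z, ¬ infDist z B < ε / 4 → AnalyticAt ℂ F z := by
    intro z hz
    apply hF.analyticAt (hclosed.isOpen_compl.mem_nhds _)
    intro hzB
    rw [infDist_zero_of_mem hzB] at hz
    exact hz (by positivity)
  have iφ : Integrable (fun z => F z * DD φ z) :=
    integrable_off B hclosed hF.continuousOn (continuous_DD hφ) (hasCompactSupport_DD hφc)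
      (hε.trans hε1) dφ1
  have iχ : Integrable (fun z => F z * DD χ z) :=
    integrable_off B hclosed hF.continuousOn (continuous_DD hχ) dχc
      (by positivity : 0 < ε / 4) dχ0
  have iuχ : Integrable (fun z => u z * DD χ z) := by
    apply Continuous.integrable_of_hasCompactSupport
    · exact hu.continuous.mul (continuous_DD hχ)
    · exact dχc.mul_left
  have hdu := hu.differentiable (by norm_num)
  have hdχ := hχ.differentiable (by norm_num)
  have hdφ := hφ.differentiable (by norm_num)
  -- step 1
  have s1 : (∫ z, F z * DD φ z) + ∫ z, F z * DD χ z = 0 := by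
    rw [← integral_add iφ iχ]
    have hev : ∀ z, infDist z B < ε / 4 → (fun z => F z * (φ z * χ z)) =ᶠ[𝓝 z] fun _ => 0 := by
      intro z hz
      filter_upwards [eχ0 z hz] with x hx
      rw [hx]; ring
    have : ∀ z, F z * DD φ z + F z * DD χ z = DD (fun z => F z * (φ z * χ z)) z := by
      intro z
      by_cases hz : infDist z B < ε / 4
      · rw [DD_congr (hev z hz), DD_const, dχ0 z hz, dφ1 z (by linarith)]
        ring
      · have hFz := (hFd z hz).differentiableAt
        rw [DD_mul (hFz.restrictScalars ℝ) ((hdφ z).fun_mul (hdχ z)), DD_holo hFz,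
          DD_mul (hdφ z) (hdχ z)]
        by_cases hz2 : infDist z B < ε1
        · rw [dφ1 z hz2, hφ1 z hz2]; ring
        · rw [dχ1 z (by linarith), hχ1 z (by linarith)]; ring
    simp_rw [this]
    apply integral_DD
    · rw [contDiff_iff_contDiffAt]
      intro z
      by_cases hz : infDist z B < ε / 4
      · exact contDiffAt_const.congr_of_eventuallyEq (hev z hz)
      · exact ((hFd z hz).contDiffAt.restrict_scalars ℝ).mul (hφ.contDiffAt.mul hχ.contDiffAt)
    · exact (hφc.mul_right).mul_left
  -- step 2
  have s2 : (∫ z, u z * DD χ z) = ∫ z, (1 - χ z) * DD u z := by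
    have i2 : Integrable (fun z => (1 - χ z) * DD u z) := by
      apply Continuous.integrable_of_hasCompactSupport
      · exact (continuous_const.sub hχ.continuous).mul (continuous_DD hu)
      · exact (hasCompactSupport_DD huc).mul_left
    rw [← sub_eq_zero, ← integral_sub iuχ i2]
    have : ∀ z, u z * DD χ z - (1 - χ z) * DD u z = DD (fun z => u z * (χ z - 1)) z := by
      intro z
      rw [DD_mul (hdu z) ((hdχ z).sub_const 1)]
      have : DD (fun z => χ z - 1) z = DD χ z := by
        unfold DD
        rw [fderiv_sub_const]
      rw [this]; ring
    simp_rw [this]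
    apply integral_DD
    · exact hu.mul (hχ.sub contDiff_const)
    · exact huc.mul_right
  have s3 : ∫ z, F z * DD φ z = -(∫ z, (F z - u z) * DD χ z) - ∫ z, (1 - χ z) * DD u z := by
    have : ∫ z, (F z - u z) * DD χ z = (∫ z, F z * DD χ z) - ∫ z, u z * DD χ z := by
      rw [← integral_sub iχ iuχ]
      congr 1; ext z; ring
    rw [this, s2]
    linear_combination s1
  have e1 : ‖∫ z, (F z - u z) * DD χ z‖ₑ ≤
      ENNReal.ofReal 8 * (ENNReal.ofReal (4 * κ ^ 2 * Real.pi / (c * (κ - 1))) *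
        ∫⁻ q, NN B κ (κ * ε) (fun z => ‖F z - u z‖ₑ) q ∂σ) := by
    have hband : MeasurableSet {z : ℂ | ε / 4 ≤ infDist z B ∧ infDist z B ≤ ε} := by
      apply MeasurableSet.inter
      · exact (isClosed_le (by fun_prop) (continuous_infDist_pt B)).measurableSet
      · exact (isClosed_le (continuous_infDist_pt B) (by fun_prop)).measurableSet
    calc _ ≤ ∫⁻ z, ‖(F z - u z) * DD χ z‖ₑ := enorm_integral_le_lintegral_enorm _
      _ ≤ ∫⁻ z, ({z : ℂ | ε / 4 ≤ infDist z B ∧ infDist z B ≤ ε}).indicator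
            (fun z => ENNReal.ofReal (8 / ε) * ‖F z - u z‖ₑ) z := by
          apply lintegral_mono
          intro z
          by_cases hz : z ∈ {z : ℂ | ε / 4 ≤ infDist z B ∧ infDist z B ≤ ε}
          · simp only [indicator_of_mem hz]
            rw [enorm_mul, mul_comm]
            gcongr
            rw [← ofReal_norm]
            apply ENNReal.ofReal_le_ofReal
            refine (norm_DD_le hχL z).trans (le_of_eq ?_)
            rw [Real.coe_toNNReal _ (by positivity)]
            ring
          · simp only [indicator_of_notMem hz]
            have : DD χ z = 0 := by
              by_cases h1 : infDist z B < ε / 4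
              · exact dχ0 z h1
              · apply dχ1 z
                by_contra h2
                exact hz ⟨by linarith, by linarith⟩
            simp [this]
      _ = ENNReal.ofReal 8 * (ENNReal.ofReal (1 / ε) *
            ∫⁻ z in {z : ℂ | ε / 4 ≤ infDist z B ∧ infDist z B ≤ ε}, ‖F z - u z‖ₑ) := by
          rw [lintegral_indicator hband, lintegral_const_mul' _ _ ENNReal.ofReal_ne_top, ← mul_assoc,
            ← ENNReal.ofReal_mul (by norm_num)]
          congr 2
          ring
      _ ≤ _ := by
          exact mul_le_mul' le_rfl (band_ineq B hB hBne σ hc hκ hε hlow hr _)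
  have e2 : ‖∫ z, (1 - χ z) * DD u z‖ₑ ≤ ENNReal.ofReal (2 * M) * volume (cthickening ε B) := by
    calc _ ≤ ∫⁻ z, ‖(1 - χ z) * DD u z‖ₑ := enorm_integral_le_lintegral_enorm _
      _ ≤ ∫⁻ z, (cthickening ε B).indicator (fun _ => ENNReal.ofReal (2 * M)) z := by
          apply lintegral_mono
          intro z
          by_cases hz : z ∈ cthickening ε B
          · simp only [indicator_of_mem hz]
            rw [← ofReal_norm]
            apply ENNReal.ofReal_le_ofReal
            rw [norm_mul]
            exact mul_le_mul (hχ2 z) (hM z) (norm_nonneg _) (by norm_num)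
          · simp only [indicator_of_notMem hz]
            rw [hcth] at hz
            have : χ z = 1 := hχ1 z (le_of_lt (by simpa using hz))
            simp [this]
      _ = _ := by
          rw [lintegral_indicator isClosed_cthickening.measurableSet, setLIntegral_const]
  rw [s3]
  calc _ ≤ ‖-(∫ z, (F z - u z) * DD χ z)‖ₑ + ‖∫ z, (1 - χ z) * DD u z‖ₑ := by
        exact enorm_sub_le
    _ ≤ _ := by
        rw [enorm_neg]
        gcongr

lemma core_zero (B : Set ℂ) (hB : IsCompact B) (hBne : B.Nonempty) (hB0 : volume B = 0)
    (σ : Measure ℂ) [IsFiniteMeasure σ] {c r0 κ ε1 : ℝ} (hc : 0 < c) (hr0 : 0 < r0) (hκ : 1 < κ)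
    (hlow : ∀ q ∈ B, ∀ r, 0 < r → r ≤ r0 → ENNReal.ofReal (c * r) ≤ σ (ball q r))
    (hε1 : 0 < ε1) {F φ h : ℂ → ℂ} (hF : DifferentiableOn ℂ F Bᶜ)
    (hφ : ContDiff ℝ 1 φ) (hφc : HasCompactSupport φ) (hφ1 : ∀ z, infDist z B < ε1 → φ z = 1)
    (hh : Integrable h σ)
    (hN : ∫⁻ q, (⨆ z ∈ {z | dist z q < κ * infDist z B}, ‖F z‖ₑ) ∂σ ≠ ⊤)
    (hlim : ∀ᵐ q ∂σ, Tendsto F (𝓝[{z | dist z q < κ * infDist z B}] q) (𝓝 (h q))) :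
    ∫ z, F z * DD φ z = 0 := by
  have hκ1 : 0 < κ - 1 := by linarith
  set K : ℝ≥0∞ := ENNReal.ofReal (4 * κ ^ 2 * Real.pi / (c * (κ - 1))) with hK
  have main : ∀ η : ℝ, 0 < η → ‖∫ z, F z * DD φ z‖ₑ ≤
      ENNReal.ofReal 8 * (K * ENNReal.ofReal η) := by
    intro η hη
    obtain ⟨u, huc, hu, hu1⟩ := (memLp_one_iff_integrable.2 hh).exist_eLpNorm_sub_le
      ENNReal.one_ne_top le_rfl (half_pos hη)
    replace hu : ContDiff ℝ 1 u := hu.of_le (by norm_cast)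
    obtain ⟨M, hM⟩ := (continuous_DD hu).bounded_above_of_compact_support (hasCompactSupport_DD huc)
    obtain ⟨M', hM'⟩ := hu.continuous.bounded_above_of_compact_support huc
    rw [eLpNorm_one_eq_lintegral_enorm] at hu1
    -- scales
    obtain ⟨e0, he0, he1, he2⟩ : ∃ e0 : ℝ, 0 < e0 ∧ e0 < ε1 ∧ (κ - 1) * e0 ≤ r0 := by
      refine ⟨min (ε1 / 2) (r0 / (κ - 1)), by positivity, ?_, ?_⟩
      · exact (min_le_left _ _).trans_lt (by linarith)
      · calc _ ≤ (κ - 1) * (r0 / (κ - 1)) := by gcongr; exact min_le_right _ _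
          _ = r0 := by field_simp
    let e : ℕ → ℝ := fun n => e0 * (1 / ((n : ℝ) + 1))
    have hepos : ∀ n, 0 < e n := fun n => by positivity
    have hele : ∀ n, e n ≤ e0 := fun n => by
      have : 1 / ((n : ℝ) + 1) ≤ 1 := by
        rw [div_le_one (by positivity)]; linarith [(Nat.cast_nonneg n : (0:ℝ) ≤ n)]
      calc e n ≤ e0 * 1 := mul_le_mul_of_nonneg_left this he0.le
        _ = e0 := mul_one _
    have het : Tendsto e atTop (𝓝 0) := by
      have := (tendsto_one_div_add_atTop_nhds_zero_nat (𝕜 := ℝ)).const_mul e0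
      simpa [e] using this
    have step : ∀ n, ‖∫ z, F z * DD φ z‖ₑ ≤ ENNReal.ofReal 8 * (K *
        ∫⁻ q, NN B κ (κ * e n) (fun z => ‖F z - u z‖ₑ) q ∂σ) +
        ENNReal.ofReal (2 * M) * volume (cthickening (e n) B) := fun n =>
      step_ineq B hB hBne σ hc hκ (hepos n) hlow
        ((mul_le_mul_of_nonneg_left (hele n) hκ1.le).trans he2)
        ((hele n).trans_lt he1) hF hφ hφc hφ1 hu huc hM
    have hls : limsup (fun n => ∫⁻ q, NN B κ (κ * e n) (fun z => ‖F z - u z‖ₑ) q ∂σ) atTop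
        ≤ ∫⁻ q, ‖(h - u) q‖ₑ ∂σ := by
      refine (limsup_lintegral_le
        (fun q => (⨆ z ∈ {z | dist z q < κ * infDist z B}, ‖F z‖ₑ) + ENNReal.ofReal M')
        (fun n => measurable_NN _ _ _ _) (fun n => Eventually.of_forall fun q => ?_) ?_).trans ?_
      · refine iSup₂_le fun z hz => ?_
        refine (enorm_sub_le).trans ?_
        refine add_le_add ?_ ?_
        · exact le_iSup₂ (f := fun z (_ : z ∈ {z | dist z q < κ * infDist z B}) => ‖F z‖ₑ) z hz.1
        · rw [← ofReal_norm]
          exact ENNReal.ofReal_le_ofReal (hM' z)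
      · rw [lintegral_add_right _ measurable_const]
        simp only [lintegral_const, ne_eq, ENNReal.add_eq_top, not_or]
        exact ⟨hN, ENNReal.mul_ne_top ENNReal.ofReal_ne_top (measure_ne_top _ _)⟩
      · apply lintegral_mono_ae
        filter_upwards [hlim] with q hq
        have hq2 : Tendsto (fun z => ‖F z - u z‖ₑ) (𝓝[{z | dist z q < κ * infDist z B}] q)
            (𝓝 ‖(h - u) q‖ₑ) := by
          refine (Tendsto.sub hq ?_).enorm
          exact hu.continuous.continuousAt.tendsto.mono_left nhdsWithin_le_nhds
        refine le_of_forall_gt fun b hb => ?_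
        obtain ⟨b', hb1, hb2⟩ := exists_between hb
        have hev := hq2.eventually_lt_const hb1
        rw [eventually_nhdsWithin_iff, Metric.eventually_nhds_iff] at hev
        obtain ⟨δ, hδ, hδ2⟩ := hev
        refine lt_of_le_of_lt ?_ hb2
        refine limsup_le_of_le (h := ?_)
        have : Tendsto (fun n => κ * e n) atTop (𝓝 0) := by simpa using het.const_mul κ
        filter_upwards [this.eventually_lt_const hδ] with n hn
        exact iSup₂_le fun z hz => (hδ2 (hz.2.trans hn) hz.1).le
    have hev : ∀ᶠ n in atTop, ‖∫ z, F z * DD φ z‖ₑ ≤ ENNReal.ofReal 8 * (K * ENNReal.ofReal η) +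
        ENNReal.ofReal (2 * M) * volume (cthickening (e n) B) := by
      have : limsup (fun n => ∫⁻ q, NN B κ (κ * e n) (fun z => ‖F z - u z‖ₑ) q ∂σ) atTop
          < ENNReal.ofReal η :=
        (hls.trans hu1).trans_lt ((ENNReal.ofReal_lt_ofReal_iff hη).2 (by linarith))
      filter_upwards [eventually_lt_of_limsup_lt this] with n hn
      exact (step n).trans (by gcongr)
    have ht : Tendsto (fun n => ENNReal.ofReal 8 * (K * ENNReal.ofReal η) +
        ENNReal.ofReal (2 * M) * volume (cthickening (e n) B)) atTop
        (𝓝 (ENNReal.ofReal 8 * (K * ENNReal.ofReal η) + ENNReal.ofReal (2 * M) * volume B)) := by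
      refine tendsto_const_nhds.add (ENNReal.Tendsto.const_mul ?_ (Or.inr ENNReal.ofReal_ne_top))
      exact (tendsto_measure_cthickening_of_isCompact hB).comp het
    have := ge_of_tendsto ht hev
    simpa [hB0] using this
  have ht : Tendsto (fun η : ℝ => ENNReal.ofReal 8 * (K * ENNReal.ofReal η)) (𝓝[>] 0)
      (𝓝 (ENNReal.ofReal 8 * (K * ENNReal.ofReal 0))) := by
    refine ENNReal.Tendsto.const_mul (ENNReal.Tendsto.const_mul ?_ (Or.inr ENNReal.ofReal_ne_top))
      (Or.inr ENNReal.ofReal_ne_top)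
    exact (ENNReal.continuous_ofReal.tendsto 0).mono_left nhdsWithin_le_nhds
  have := ge_of_tendsto ht (eventually_nhdsWithin_of_forall fun η hη => main η hη)
  simpa using this

lemma DD_radial {s : ℝ → ℝ} (hs : Differentiable ℝ s) (z : ℂ) :
    DD (fun z => ((s (‖z‖ ^ 2) : ℝ) : ℂ)) z = 2 * ((deriv s (‖z‖ ^ 2) : ℝ) : ℂ) * z := by
  have h1 : HasFDerivAt (fun z : ℂ => ‖z‖ ^ 2) (2 • (innerSL ℝ z)) z := by
    have := (hasStrictFDerivAt_norm_sq z).hasFDerivAt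
    simpa using this
  have h2 := (hs (‖z‖ ^ 2)).hasDerivAt.comp_hasFDerivAt z h1
  have h3 := (ofRealCLM.hasFDerivAt).comp z h2
  have h4 : fderiv ℝ (fun z : ℂ => ((s (‖z‖ ^ 2) : ℝ) : ℂ)) z = _ := h3.fderiv
  unfold DD
  rw [h4]
  apply Complex.ext <;> simp [Complex.inner] <;> ring

lemma core_eq_zero (B : Set ℂ) (hB : IsCompact B) (hBne : B.Nonempty) (hB0 : volume B = 0)
    (σ : Measure ℂ) [IsFiniteMeasure σ] (hσ : ∀ᵐ q ∂σ, q ∈ B)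
    {c r0 κ : ℝ} (hc : 0 < c) (hr0 : 0 < r0) (hκ : 1 < κ)
    (hlow : ∀ q ∈ B, ∀ r, 0 < r → r ≤ r0 → ENNReal.ofReal (c * r) ≤ σ (ball q r))
    {F h : ℂ → ℂ} (hF : DifferentiableOn ℂ F Bᶜ) (hF0 : Tendsto F (cocompact ℂ) (𝓝 0))
    (hh : Integrable h σ)
    (hN : ∫⁻ q, (⨆ z ∈ {z | dist z q < κ * infDist z B}, ‖F z‖ₑ) ∂σ ≠ ⊤)
    (hlim : ∀ᵐ q ∂σ, Tendsto F (𝓝[{z | dist z q < κ * infDist z B}] q) (𝓝 (h q)))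
    (z0 : ℂ) (hz0 : z0 ∉ B) : F z0 = 0 := by
  have hopen : IsOpen Bᶜ := hB.isClosed.isOpen_compl
  set G : ℂ → ℂ := dslope F z0 with hGdef
  have hGd : DifferentiableOn ℂ G Bᶜ := (differentiableOn_dslope (hopen.mem_nhds hz0)).2 hF
  have hGne : ∀ z, z ≠ z0 → G z = (z - z0)⁻¹ * (F z - F z0) := fun z hz => by
    rw [hGdef, dslope_of_ne _ hz, slope_def_field, div_eq_inv_mul]
  have hGc : ContinuousAt G z0 := hGd.continuousOn.continuousAt (hopen.mem_nhds hz0)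
  -- bound near z0
  obtain ⟨ρ, hρ, hρ1, hρ2⟩ : ∃ ρ > 0, (∀ z, dist z z0 < ρ → ‖G z‖ < ‖G z0‖ + 1) ∧
      ∀ q ∈ B, ρ ≤ dist q z0 := by
    have h1 : ∀ᶠ z in 𝓝 z0, ‖G z‖ < ‖G z0‖ + 1 :=
      hGc.norm.tendsto.eventually_lt_const (by linarith)
    have h2 : ∀ᶠ z in 𝓝 z0, z ∈ Bᶜ := hopen.mem_nhds hz0
    obtain ⟨ρ, hρ, H⟩ := Metric.eventually_nhds_iff.1 (h1.and h2)
    exact ⟨ρ, hρ, fun z hz => (H hz).1, fun q hq => not_lt.1 fun hlt => (H hlt).2 hq⟩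
  set A : ℝ := (‖G z0‖ + 1) + (1 + ‖F z0‖) / ρ with hA
  have hApos : 0 < A := by positivity
  have hGA : ∀ z, ‖G z‖ ≤ A * (1 + ‖F z‖) := by
    intro z
    by_cases hz : dist z z0 < ρ
    · have h1 := (hρ1 z hz).le
      have h2 : 0 ≤ (1 + ‖F z0‖) / ρ := by positivity
      nlinarith [norm_nonneg (F z)]
    · have hz' : z ≠ z0 := by rintro rfl; exact hz (by simpa using hρ)
      rw [hGne z hz', norm_mul, norm_inv, ← dist_eq]
      have h3 : (dist z z0)⁻¹ ≤ ρ⁻¹ := by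
        apply inv_anti₀ hρ (not_lt.1 hz)
      calc _ ≤ ρ⁻¹ * (‖F z‖ + ‖F z0‖) := by gcongr; exact norm_sub_le _ _
        _ ≤ ρ⁻¹ * ((1 + ‖F z0‖) * (1 + ‖F z‖)) := by
            gcongr
            nlinarith [norm_nonneg (F z), norm_nonneg (F z0), mul_nonneg (norm_nonneg (F z)) (norm_nonneg (F z0))]
        _ = (1 + ‖F z0‖) / ρ * (1 + ‖F z‖) := by ring
        _ ≤ _ := by
            gcongr
            rw [hA]; linarith [norm_nonneg (G z0)]
  have hGN : ∫⁻ q, (⨆ z ∈ {z | dist z q < κ * infDist z B}, ‖G z‖ₑ) ∂σ ≠ ⊤ := by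
    have hle : ∫⁻ q, (⨆ z ∈ {z | dist z q < κ * infDist z B}, ‖G z‖ₑ) ∂σ ≤
        ∫⁻ q, ENNReal.ofReal A * (1 + ⨆ z ∈ {z | dist z q < κ * infDist z B}, ‖F z‖ₑ) ∂σ := by
      apply lintegral_mono
      intro q
      refine iSup₂_le fun z hz => ?_
      have h1 : ‖G z‖ₑ ≤ ENNReal.ofReal A * (1 + ‖F z‖ₑ) := by
        rw [← ofReal_norm, ← ofReal_norm, ← ENNReal.ofReal_one, ← ENNReal.ofReal_add (by norm_num) (norm_nonneg _),
          ← ENNReal.ofReal_mul hApos.le]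
        exact ENNReal.ofReal_le_ofReal (hGA z)
      refine h1.trans (mul_le_mul' le_rfl (add_le_add le_rfl ?_))
      exact le_iSup₂ (f := fun z (_ : z ∈ {z | dist z q < κ * infDist z B}) => ‖F z‖ₑ) z hz
    refine ne_top_of_le_ne_top ?_ hle
    rw [lintegral_const_mul' _ _ ENNReal.ofReal_ne_top, lintegral_add_left measurable_const]
    refine ENNReal.mul_ne_top ENNReal.ofReal_ne_top (ENNReal.add_ne_top.2 ⟨?_, hN⟩)
    simp
  have hGlim : ∀ᵐ q ∂σ, Tendsto G (𝓝[{z | dist z q < κ * infDist z B}] q)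
      (𝓝 ((q - z0)⁻¹ * (h q - F z0))) := by
    filter_upwards [hσ, hlim] with q hqB hq
    have hqz : q - z0 ≠ 0 := by
      intro h0
      exact hz0 (by rwa [← sub_eq_zero.1 h0])
    have ht : Tendsto (fun z => (z - z0)⁻¹ * (F z - F z0)) (𝓝[{z | dist z q < κ * infDist z B}] q)
        (𝓝 ((q - z0)⁻¹ * (h q - F z0))) := by
      refine Tendsto.mul ?_ (hq.sub_const _)
      refine Tendsto.mono_left ?_ nhdsWithin_le_nhds
      exact ((continuous_id.sub continuous_const).tendsto q).inv₀ hqz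
    refine ht.congr' ?_
    have : ∀ᶠ z in 𝓝 q, z ≠ z0 := isOpen_ne.mem_nhds (sub_ne_zero.1 hqz)
    filter_upwards [mem_nhdsWithin_of_mem_nhds this] with z hz using (hGne z hz).symm
  have hGh : Integrable (fun q => (q - z0)⁻¹ * (h q - F z0)) σ := by
    refine Integrable.bdd_mul (c := ρ⁻¹) (hh.sub (integrable_const _)) ?_ ?_
    · exact (measurable_id.sub_const z0).inv.aestronglyMeasurable
    · filter_upwards [hσ] with q hq
      rw [norm_inv, ← dist_eq]
      exact inv_anti₀ hρ (hρ2 q hq)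
  have hzG : Tendsto (fun z => z * G z + F z0) (Bornology.cobounded ℂ) (𝓝 0) := by
    rw [← Metric.cobounded_eq_cocompact] at hF0
    have h1 : Tendsto (fun z : ℂ => (z - z0)⁻¹) (Bornology.cobounded ℂ) (𝓝 0) := by
      refine tendsto_inv₀_cobounded.comp ?_
      exact tendsto_sub_const_cobounded z0
    have h2 : Tendsto (fun z : ℂ => (1 + z0 * (z - z0)⁻¹) * (F z - F z0) + F z0)
        (Bornology.cobounded ℂ) (𝓝 ((1 + z0 * 0) * (0 - F z0) + F z0)) :=
      ((tendsto_const_nhds.add (h1.const_mul z0)).mul (hF0.sub_const _)).add_const _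
    have h3 : (1 + z0 * 0) * (0 - F z0) + F z0 = 0 := by ring
    rw [h3] at h2
    refine h2.congr' ?_
    filter_upwards [(hasBasis_cobounded_norm (E := ℂ)).mem_of_mem (i := ‖z0‖ + 1) trivial] with z hz
    have hz' : z ≠ z0 := by
      rintro rfl
      simp at hz
      linarith
    have hz2 : z - z0 ≠ 0 := sub_ne_zero.2 hz'
    rw [hGne z hz']
    field_simp
    ring
  -- conclusion
  rw [← norm_le_zero_iff]
  refine le_of_forall_pos_le_add fun η hη => ?_
  rw [zero_add]
  obtain ⟨R1, -, hR1⟩ := (hasBasis_cobounded_norm (E := ℂ)).eventually_iff.1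
    (hzG.norm.eventually_lt_const (by simpa using hη : ‖(0:ℂ)‖ < η))
  obtain ⟨R2, hR2⟩ := hB.isBounded.exists_norm_le
  obtain ⟨R, hRpos, hRR1, hRR2⟩ : ∃ R : ℝ, 0 < R ∧ R1 ≤ R ∧ R2 + 1 ≤ R :=
    ⟨max 1 (max R1 (R2 + 1)), by positivity, by simp, by simp⟩
  let s : ℝ → ℝ := fun t => Real.smoothTransition (2 - t / R ^ 2)
  have hsC : ContDiff ℝ 1 s := by
    refine (Real.smoothTransition.contDiff (n := 1)).comp ?_
    fun_prop
  have hs1 : ∀ t, t ≤ R ^ 2 → s t = 1 := fun t ht => by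
    apply Real.smoothTransition.one_of_one_le
    have : t / R ^ 2 ≤ 1 := by rw [div_le_one (by positivity)]; exact ht
    linarith
  have hs0 : ∀ t, 2 * R ^ 2 ≤ t → s t = 0 := fun t ht => by
    apply Real.smoothTransition.zero_of_nonpos
    have : 2 ≤ t / R ^ 2 := by rw [le_div_iff₀ (by positivity)]; exact ht
    linarith
  have hsanti : Antitone s := by
    intro a b hab
    apply Real.smoothTransition.monotone
    gcongr
  let φ : ℂ → ℂ := fun z => ((s (‖z‖ ^ 2) : ℝ) : ℂ)
  have hφC : ContDiff ℝ 1 φ := by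
    refine ofRealCLM.contDiff.comp (hsC.comp ?_)
    exact contDiff_norm_sq ℝ
  have hφc : HasCompactSupport φ := by
    refine HasCompactSupport.of_support_subset_isCompact (isCompact_closedBall (0:ℂ) (2 * R)) ?_
    intro z hz
    by_contra hcon
    apply hz
    simp only [mem_closedBall, dist_zero_right, not_le] at hcon
    simp only [φ]
    rw [hs0 _ (by nlinarith)]
    simp
  have hφ1 : ∀ z, infDist z B < 1 → φ z = 1 := by
    intro z hz
    obtain ⟨q, hq, hzq⟩ := (infDist_lt_iff hBne).1 hz
    have h1 : ‖z‖ ≤ R := by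
      have h2 := norm_add_le (z - q) q
      rw [sub_add_cancel, ← dist_eq] at h2
      linarith [hR2 q hq]
    simp only [φ]
    rw [hs1 _ (by gcongr)]
    simp
  have hzero := core_zero B hB hBne hB0 σ hc hr0 hκ hlow one_pos hGd hφC hφc hφ1 hGh hGN hGlim
  let k : ℂ → ℝ := fun z => - deriv s (‖z‖ ^ 2)
  have hk0 : ∀ z, 0 ≤ k z := fun z => by
    simp only [k]
    linarith [hsanti.deriv_nonpos (x := ‖z‖ ^ 2)]
  have hkc : Continuous k := by
    have := hsC.continuous_deriv (by norm_num)
    fun_prop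
  have hDD : ∀ z, DD φ z = -2 * (k z : ℂ) * z := fun z => by
    have h1 : DD φ z = _ := DD_radial (hsC.differentiable (by norm_num)) z
    rw [h1]
    simp [k]
  have hksupp : ∀ z, ‖z‖ < R → k z = 0 := by
    intro z hz
    have : s =ᶠ[𝓝 (‖z‖ ^ 2)] fun _ => 1 := by
      filter_upwards [Iio_mem_nhds (by gcongr : ‖z‖ ^ 2 < R ^ 2)] with t ht using hs1 t (le_of_lt ht)
    simp [k, this.deriv_eq]
  have hksupp2 : ∀ z, 2 * R < ‖z‖ → k z = 0 := by
    intro z hz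
    have : s =ᶠ[𝓝 (‖z‖ ^ 2)] fun _ => 0 := by
      filter_upwards [Ioi_mem_nhds (by nlinarith : 2 * R ^ 2 < ‖z‖ ^ 2)] with t ht using hs0 t (le_of_lt ht)
    simp [k, this.deriv_eq]
  have hkcs : HasCompactSupport k := by
    refine HasCompactSupport.of_support_subset_isCompact (isCompact_closedBall (0:ℂ) (2 * R)) ?_
    intro z hz
    by_contra hcon
    simp only [mem_closedBall, dist_zero_right, not_le] at hcon
    exact hz (hksupp2 z hcon)
  have hkint : Integrable k := hkc.integrable_of_hasCompactSupport hkcs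
  have hkpos : 0 < ∫ z, k z := by
    obtain ⟨x, hx⟩ : ∃ x, k x ≠ 0 := by
      by_contra! hcon
      have hd : ∀ t, deriv s t = 0 := by
        intro t
        by_cases ht : 0 ≤ t
        · have := hcon ((Real.sqrt t : ℝ) : ℂ)
          simpa [k, Real.sq_sqrt ht] using this
        · have : s =ᶠ[𝓝 t] fun _ => 1 := by
            filter_upwards [Iio_mem_nhds (not_le.1 ht)] with t ht
            exact hs1 t (le_trans (le_of_lt ht) (by positivity))
          simp [this.deriv_eq]
      have h1 := is_const_of_deriv_eq_zero (hsC.differentiable (by norm_num)) hd (R ^ 2) (2 * R ^ 2)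
      rw [hs1 _ le_rfl, hs0 _ le_rfl] at h1
      norm_num at h1
    exact hkc.integral_pos_of_hasCompactSupport_nonneg_nonzero hkcs hk0 hx
  have hGk : Integrable (fun z => G z * DD φ z) :=
    integrable_off B hB.isClosed hGd.continuousOn (continuous_DD hφC) (hasCompactSupport_DD hφc)
      one_pos (fun z hz => by
        have : φ =ᶠ[𝓝 z] fun _ => 1 := by
          filter_upwards [(isOpen_lt (continuous_infDist_pt B) continuous_const).mem_nhds hz]
            with x hx using hφ1 x hx
        rw [DD_congr this, DD_const])
  have hrep : ∫ z, (z * G z + F z0) * (k z : ℂ) = F z0 * ((∫ z, k z : ℝ) : ℂ) := by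
    have h1 : ∀ z, (z * G z + F z0) * (k z : ℂ) = (-1 / 2) * (G z * DD φ z) + F z0 * (k z : ℂ) := by
      intro z
      rw [hDD]; ring
    simp_rw [h1]
    have i2 : Integrable (fun z => F z0 * ((k z : ℝ) : ℂ)) := (hkint.ofReal (𝕜 := ℂ)).const_mul _
    rw [integral_add (hGk.const_mul _) i2, integral_const_mul, hzero,
      integral_const_mul, integral_complex_ofReal]
    simp
  have hbd : ‖∫ z, (z * G z + F z0) * (k z : ℂ)‖ ≤ ∫ z, η * k z := by
    apply norm_integral_le_of_norm_le (hkint.const_mul _)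
    refine Eventually.of_forall fun z => ?_
    by_cases hz : ‖z‖ < R
    · simp [hksupp z hz]
    · rw [norm_mul, norm_real, Real.norm_eq_abs, abs_of_nonneg (hk0 z)]
      have := hR1 (hRR1.trans (not_lt.1 hz) : R1 ≤ ‖z‖)
      have h0 := hk0 z
      exact mul_le_mul_of_nonneg_right (le_of_lt this) h0
  rw [hrep, integral_const_mul, norm_mul, norm_real, Real.norm_eq_abs, abs_of_pos hkpos] at hbd
  exact le_of_mul_le_mul_right hbd hkpos

lemma jordan_finite {Ω : Set ℂ} {γ : ℝ → ℂ} (hΩ : LipschitzJordanDomain Ω γ) :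
    μH[1] (frontier Ω) ≠ ⊤ := by
  obtain ⟨K, hK⟩ := hΩ.lipschitz
  rw [← hΩ.image]
  have h1 := hK.hausdorffMeasure_image_le (d := 1) zero_le_one
  refine ne_top_of_le_ne_top ?_ h1
  rw [hausdorffMeasure_real]
  refine ENNReal.mul_ne_top (by simp) (by simp)

lemma jordan_vol {Ω : Set ℂ} {γ : ℝ → ℂ} (hΩ : LipschitzJordanDomain Ω γ) :
    volume (frontier Ω) = 0 := by
  have h2 : μH[2] (frontier Ω) = 0 := by
    rcases Measure.hausdorffMeasure_zero_or_top (one_lt_two : (1:ℝ) < 2) (frontier Ω) with h | h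
    · exact h
    · exact absurd h (jordan_finite hΩ)
  have h3 : μH[2] (Complex.equivRealProdCLM '' frontier Ω) = 0 := by
    have := (Complex.equivRealProdCLM.toContinuousLinearMap.lipschitz.lipschitzOnWith
      (s := frontier Ω)).hausdorffMeasure_image_le (d := 2) (by norm_num)
    rw [h2, mul_zero] at this
    exact le_antisymm this bot_le
  rw [hausdorffMeasure_prod_real] at h3
  rw [← Complex.volume_preserving_equiv_real_prod.symm.measure_preimage_equiv]
  convert h3 using 2
  ext x
  constructor
  · intro hx
    exact ⟨_, hx, by simp⟩
  · rintro ⟨y, hy, rfl⟩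
    simpa using hy

lemma jordan_lower {Ω : Set ℂ} {γ : ℝ → ℂ} (hΩ : LipschitzJordanDomain Ω γ) :
    ∃ c > 0, ∃ r0 > 0, ∀ q ∈ frontier Ω, ∀ r, 0 < r → r ≤ r0 →
      ENNReal.ofReal (c * r) ≤ (μH[1]).restrict (frontier Ω) (ball q r) := by
  obtain ⟨K, hK⟩ := hΩ.lipschitz
  obtain ⟨c, hc, hbi⟩ := hΩ.biLip
  let K' : ℝ := K + 1
  have hK' : 0 < K' := by positivity
  refine ⟨c / (2 * K'), by positivity, K' / 2, by positivity, fun q hq r hr hr0 => ?_⟩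
  rw [← hΩ.image] at hq
  obtain ⟨s, hs, rfl⟩ := hq
  let l : ℝ := r / (2 * K')
  have hl : 0 < l := by positivity
  have hl4 : l ≤ 1 / 4 := by
    simp only [l]
    rw [div_le_iff₀ (by positivity)]
    linarith
  obtain ⟨a, ha0, ha1, has⟩ : ∃ a, 0 ≤ a ∧ a + l ≤ 1 ∧ ∀ t ∈ Icc a (a + l), |t - s| ≤ l := by
    by_cases h : s ≤ 1 / 2
    · refine ⟨s, hs.1, by linarith, fun t ht => ?_⟩
      rw [abs_le]; constructor <;> linarith [ht.1, ht.2]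
    · refine ⟨s - l, by linarith, by linarith [hs.2], fun t ht => ?_⟩
      rw [abs_le]; constructor <;> linarith [ht.1, ht.2]
  set J : Set ℝ := Icc a (a + l) with hJ
  have hJI : J ⊆ Icc 0 1 := Icc_subset_Icc ha0 ha1
  have hsub : γ '' J ⊆ ball (γ s) r ∩ frontier Ω := by
    rintro _ ⟨t, ht, rfl⟩
    refine ⟨?_, by rw [← hΩ.image]; exact ⟨t, hJI ht, rfl⟩⟩
    have h1 := hK.dist_le_mul t (hJI ht) s hs
    rw [Real.dist_eq] at h1
    rw [mem_ball]
    calc _ ≤ K * |t - s| := h1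
      _ ≤ K * l := by gcongr; exact has t ht
      _ < K' * (2 * l) := by
        have : (0:ℝ) ≤ K := K.2
        simp only [K']
        nlinarith
      _ = r := by simp only [l]; field_simp
  have hbiJ : ∀ x ∈ J, ∀ y ∈ J, c * dist x y ≤ dist (γ x) (γ y) := by
    intro x hx y hy
    have h1 : |x - y| ≤ 1 / 4 := by
      rw [abs_le]; constructor <;> linarith [hx.1, hx.2, hy.1, hy.2]
    have h2 := hbi x (hJI hx) y (hJI hy)
    rw [min_eq_left (by linarith)] at h2
    rwa [Real.dist_eq]
  have hinj : InjOn γ J := by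
    intro x hx y hy hxy
    have h1 := hbiJ x hx y hy
    rw [hxy, dist_self] at h1
    have h2 : dist x y ≤ 0 := by
      by_contra hcon
      have := mul_pos hc (not_le.1 hcon)
      linarith
    exact dist_le_zero.1 h2
  let c' : ℝ≥0 := ⟨c⁻¹, by positivity⟩
  have hinv : LipschitzOnWith c' (Function.invFunOn γ J) (γ '' J) := by
    apply LipschitzOnWith.of_dist_le_mul
    rintro _ ⟨x, hx, rfl⟩ _ ⟨y, hy, rfl⟩
    rw [hinj.leftInvOn_invFunOn hx, hinj.leftInvOn_invFunOn hy]
    show dist x y ≤ c⁻¹ * _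
    rw [inv_mul_eq_div, le_div_iff₀ hc, mul_comm]
    exact hbiJ x hx y hy
  have h1 := hinv.hausdorffMeasure_image_le (d := 1) zero_le_one
  rw [hinj.leftInvOn_invFunOn.image_image, hausdorffMeasure_real, hJ, Real.volume_Icc] at h1
  rw [Measure.restrict_apply measurableSet_ball]
  calc ENNReal.ofReal (c / (2 * K') * r) = ENNReal.ofReal c * ENNReal.ofReal l := by
        rw [← ENNReal.ofReal_mul hc.le]; congr 1; simp only [l]; ring
    _ ≤ ENNReal.ofReal c * (ENNReal.ofReal c⁻¹ * μH[1] (γ '' J)) := by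
        gcongr
        have e1 : a + l - a = l := by ring
        have e2 : (c' : ℝ≥0∞) = ENNReal.ofReal c⁻¹ := by
          rw [ENNReal.ofReal, Real.toNNReal_of_nonneg (by positivity)]; rfl
        rw [e1, ENNReal.rpow_one, e2] at h1
        exact h1
    _ = μH[1] (γ '' J) := by
        rw [← mul_assoc, ← ENNReal.ofReal_mul hc.le, mul_inv_cancel₀ hc.ne', ENNReal.ofReal_one, one_mul]
    _ ≤ _ := measure_mono hsub

lemma graph_of_frontier {Ω R : Set ℂ} (hΩ : IsOpen Ω) {e : ℂ} {φ : ℝ → ℝ} (hφ : Continuous φ)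
    (hR : R ∩ Ω = R ∩ {z : ℂ | φ ((e * z).re) < (e * z).im}) {q : ℂ} (hq : q ∈ frontier Ω)
    (hqR : q ∈ interior R) : (e * q).im = φ ((e * q).re) := by
  apply le_antisymm
  · by_contra hcon
    have h1 : q ∈ R ∩ Ω := by
      rw [hR]; exact ⟨interior_subset hqR, not_le.1 hcon⟩
    rw [hΩ.frontier_eq] at hq
    exact hq.2 h1.2
  · have hq' : q ∈ closure Ω := frontier_subset_closure hq
    have h1 : q ∈ closure (interior R ∩ Ω) :=
      isOpen_interior.inter_closure ⟨hqR, hq'⟩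
    have h2 : IsClosed {z : ℂ | φ ((e * z).re) ≤ (e * z).im} :=
      isClosed_le (by fun_prop) (by fun_prop)
    have h3 : interior R ∩ Ω ⊆ {z : ℂ | φ ((e * z).re) ≤ (e * z).im} := by
      rintro z ⟨hz1, hz2⟩
      have : z ∈ R ∩ Ω := ⟨interior_subset hz1, hz2⟩
      rw [hR] at this
      have h4 : φ ((e * z).re) < (e * z).im := this.2
      exact h4.le
    exact h2.closure_subset_iff.2 h3 h1

lemma neBot_of_diff {Ω R : Set ℂ} (hΩ : IsOpen Ω) {e E : ℂ} (he : ‖e‖ = 1) (heE : e * E = 1)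
    {φ : ℝ → ℝ} (hφ : Continuous φ)
    (hR : R ∩ Ω = R ∩ {z : ℂ | φ ((e * z).re) < (e * z).im}) {q : ℂ} (hq : q ∈ frontier Ω)
    (hqR : q ∈ interior R) (hd : DifferentiableAt ℝ φ ((e * q).re)) {κ : ℝ} (hκ : 1 < κ) :
    (𝓝[ntCone Ω (frontier Ω) κ q] q).NeBot := by
  set x := (e * q).re with hx
  set m := deriv φ x with hm
  have hqg : (e * q).im = φ x := graph_of_frontier hΩ hφ hR hq hqR
  set s := Real.sqrt (1 + m ^ 2) with hs
  have hs2 : s ^ 2 = 1 + m ^ 2 := Real.sq_sqrt (by positivity)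
  have hs1 : 1 ≤ s := by
    rw [hs, Real.one_le_sqrt]; nlinarith [sq_nonneg m]
  have hspos : 0 < s := by linarith
  have hnE : ‖E‖ = 1 := by
    have := congrArg norm heE
    rw [norm_mul, he, one_mul, norm_one] at this
    exact this
  let u : ℂ := ⟨-m, 1⟩
  have hu : ‖u‖ = s := by
    rw [Complex.norm_def, hs]; congr 1; simp [u, Complex.normSq_apply]; ring
  let η : ℝ := (1 - 1 / κ) / 4
  have hκi : 1 / κ < 1 := by rw [div_lt_one (by linarith)]; exact hκ
  have hκi0 : 0 < 1 / κ := by positivity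
  have hη : 0 < η := by simp only [η]; linarith
  have hη1 : η < 1 / 4 := by simp only [η]; linarith
  have hκη : 1 < κ * (1 - 2 * η) := by
    have : κ * (1 - 2 * η) = (κ + 1) / 2 := by simp only [η]; field_simp; ring
    linarith
  -- differentiability estimate
  obtain ⟨ρ, hρ, hρR, hρd⟩ : ∃ ρ > 0, ball q ρ ⊆ interior R ∧
      ∀ a : ℝ, |a| < ρ → |φ (x + a) - φ x - m * a| ≤ η * |a| := by
    have h1 := hd.hasDerivAt.isLittleO.def hη
    obtain ⟨ρ1, hρ1, H1⟩ := Metric.eventually_nhds_iff.1 h1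
    obtain ⟨ρ2, hρ2, H2⟩ := Metric.isOpen_iff.1 isOpen_interior q hqR
    refine ⟨min ρ1 ρ2, by positivity, (ball_subset_ball (min_le_right _ _)).trans H2, fun a ha => ?_⟩
    have h2 := H1 (y := x + a) (by simpa [Real.dist_eq] using ha.trans_le (min_le_left _ _))
    simp only [add_sub_cancel_left, Real.norm_eq_abs, smul_eq_mul] at h2
    rwa [mul_comm m a]
  let Z : ℝ → ℂ := fun r => q + (r : ℂ) * (E * u)
  have hZd : ∀ r, 0 < r → dist (Z r) q = r * s := by
    intro r hr
    simp only [Z, dist_eq]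
    rw [add_sub_cancel_left, norm_mul, norm_mul, hnE, hu, norm_real, Real.norm_eq_abs, abs_of_pos hr]
    ring
  have hcone : ∀ r, 0 < r → r * s < ρ / 2 → Z r ∈ ntCone Ω (frontier Ω) κ q := by
    intro r hr hrs
    have heZ : e * Z r = e * q + r * u := by
      simp only [Z]
      linear_combination (r * u) * heE
    have hrele : r ≤ r * s := by nlinarith
    refine ⟨?_, ?_⟩
    · have hmem : Z r ∈ R := by
        apply interior_subset
        apply hρR
        rw [mem_ball, hZd r hr]
        linarith
      have : Z r ∈ R ∩ {z : ℂ | φ ((e * z).re) < (e * z).im} := by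
        refine ⟨hmem, ?_⟩
        show φ ((e * Z r).re) < (e * Z r).im
        have hre : (e * Z r).re = x + (-(r * m)) := by rw [heZ]; simp [u, hx]
        have him : (e * Z r).im = φ x + r := by rw [heZ]; simp [u, hqg]
        have hrm : |-(r * m)| ≤ r * s := by
          rw [abs_neg, abs_mul, abs_of_pos hr]
          gcongr
          rw [hs]; apply Real.abs_le_sqrt; linarith
        rw [hre, him]
        have h1 := hρd (-(r * m)) (by linarith)
        have h2 := (abs_le.1 h1).2
        have h3 : η * |-(r * m)| ≤ η * (r * s) := by gcongr
        have h5 : η * s < s ^ 2 := by nlinarith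
        have h6 : r * (η * s) < r * (1 + m ^ 2) := by rw [← hs2]; gcongr
        nlinarith
      rw [← hR] at this
      exact this.2
    · rw [hZd r hr]
      have hlow : r * s * (1 - 2 * η) ≤ infDist (Z r) (frontier Ω) := by
        rw [le_infDist ⟨q, hq⟩]
        intro b hb
        by_cases hfar : 2 * (r * s) ≤ dist b q
        · have h1 := dist_triangle_left b q (Z r)
          rw [hZd r hr] at h1
          have h2 : r * s * (1 - 2 * η) ≤ r * s := by
            have : 0 < r * s := by positivity
            nlinarith
          linarith
        · push Not at hfar
          have hbR : b ∈ interior R := hρR (by rw [mem_ball]; linarith)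
          have hbg := graph_of_frontier hΩ hφ hR hb hbR
          set v : ℂ := e * (b - q) with hv
          have hvn : ‖v‖ = dist b q := by rw [hv, norm_mul, he, one_mul, dist_eq]
          have heb : e * b = e * q + v := by rw [hv]; ring
          have hvre : |v.re| ≤ dist b q := by rw [← hvn]; exact abs_re_le_norm v
          have h1 := hρd v.re (by linarith)
          have h2 : φ (x + v.re) = φ x + v.im := by
            have := hbg
            rw [heb] at this
            simp only [add_re, add_im] at this
            rw [← hx, hqg] at this
            exact this.symm
          rw [h2] at h1
          have h3 : v.im - m * v.re ≤ η * (2 * (r * s)) := by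
            have h4 := (abs_le.1 h1).2
            have h5 : η * |v.re| ≤ η * (2 * (r * s)) := by gcongr; linarith
            linarith
          have h6 : dist (Z r) b = ‖(r : ℂ) * u - v‖ := by
            have : (r : ℂ) * u - v = e * (Z r - b) := by rw [hv]; linear_combination -heZ
            rw [this, norm_mul, he, one_mul, dist_eq]
          have h7 : ((starRingEnd ℂ) u * ((r : ℂ) * u - v)).re ≤ s * dist (Z r) b := by
            rw [h6, ← hu]
            refine (re_le_norm _).trans ?_
            rw [norm_mul, norm_conj]
          have h8 : ((starRingEnd ℂ) u * ((r : ℂ) * u - v)).re = r * s ^ 2 - (v.im - m * v.re) := by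
            rw [hs2]; simp [u]; ring
          rw [h8] at h7
          have h9 : s * (r * s * (1 - 2 * η)) ≤ s * dist (Z r) b := by
            have : η * (2 * (r * s)) ≤ s * (η * (2 * (r * s))) := by
              have : 0 ≤ η * (2 * (r * s)) := by positivity
              nlinarith
            nlinarith
          exact le_of_mul_le_mul_left h9 hspos
      have hκ0 : 0 < κ := by linarith
      have hrs0 : 0 < r * s := by positivity
      calc r * s = r * s * 1 := by ring
        _ < r * s * (κ * (1 - 2 * η)) := by gcongr
        _ = κ * (r * s * (1 - 2 * η)) := by ring
        _ ≤ _ := by gcongr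
  have ht : Tendsto Z (𝓝[>] 0) (𝓝[ntCone Ω (frontier Ω) κ q] q) := by
    refine tendsto_nhdsWithin_iff.2 ⟨?_, ?_⟩
    · refine Tendsto.mono_left ?_ nhdsWithin_le_nhds
      have hc : Continuous Z := by fun_prop
      simpa [Z] using hc.tendsto 0
    · have : ∀ᶠ r : ℝ in 𝓝[>] 0, r < ρ / 2 / s :=
        mem_nhdsWithin_of_mem_nhds (Iio_mem_nhds (by positivity))
      filter_upwards [this, self_mem_nhdsWithin] with r hr hr0
      exact hcone r hr0 ((lt_div_iff₀ hspos).1 hr)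
  exact ht.neBot

lemma ae_neBot {Ω : Set ℂ} {γ : ℝ → ℂ} (hΩ : LipschitzJordanDomain Ω γ) {κ : ℝ} (hκ : 1 < κ) :
    ∀ᵐ q ∂((μH[1]).restrict (frontier Ω)), (𝓝[ntCone Ω (frontier Ω) κ q] q).NeBot := by
  rw [ae_restrict_iff' isClosed_frontier.measurableSet]
  show μH[1] {q | ¬ (q ∈ frontier Ω → _)} = 0
  apply measure_null_of_locally_null
  intro q0 hq0
  have hq0' : q0 ∈ frontier Ω := by
    by_contra hcon
    exact hq0 fun h => absurd h hcon
  obtain ⟨θ, φ, K, R, hR, hφ, hRΩ⟩ := hΩ.lipGraph q0 hq0'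
  set e : ℂ := Complex.exp (-(θ:ℂ) * I) with he
  set E : ℂ := Complex.exp ((θ:ℂ) * I) with hE
  have heE : e * E = 1 := by rw [he, hE, ← Complex.exp_add]; simp
  have hen : ‖e‖ = 1 := by
    have := Complex.norm_exp_ofReal_mul_I (-θ)
    rw [he]; simpa using this
  let Γ : ℝ → ℂ := fun x => E * ((x : ℂ) + (φ x : ℂ) * I)
  let D : Set ℝ := {x | ¬ DifferentiableAt ℝ φ x}
  have hD : volume D = 0 := hφ.ae_differentiableAt_real
  have hΓ : ∃ L, LipschitzWith L Γ := by
    refine ⟨‖E‖₊ * (1 + K), LipschitzWith.of_dist_le_mul fun x y => ?_⟩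
    have h1 := hφ.dist_le_mul x y
    rw [Real.dist_eq, Real.dist_eq] at h1
    rw [dist_eq, Real.dist_eq]
    have : Γ x - Γ y = E * (((x - y : ℝ) : ℂ) + ((φ x - φ y : ℝ) : ℂ) * I) := by
      simp only [Γ]; push_cast; ring
    rw [this, norm_mul]
    push_cast
    rw [mul_assoc]
    gcongr
    refine (norm_add_le _ _).trans ?_
    rw [← ofReal_sub, ← ofReal_sub, norm_mul, norm_I, mul_one, norm_real, norm_real, Real.norm_eq_abs, Real.norm_eq_abs]
    linarith
  obtain ⟨L, hL⟩ := hΓ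
  have hnull : μH[1] (Γ '' D) = 0 := by
    have h1 := (hL.lipschitzOnWith (s := D)).hausdorffMeasure_image_le (d := 1) zero_le_one
    rw [hausdorffMeasure_real, hD, mul_zero] at h1
    exact le_antisymm h1 bot_le
  refine ⟨_, inter_mem_nhdsWithin _ (interior_mem_nhds.2 hR), measure_mono_null ?_ hnull⟩
  rintro q ⟨hq, hqR⟩
  rw [mem_ofPred_eq, Classical.not_imp] at hq
  have hg := graph_of_frontier hΩ.isOpen hφ.continuous hRΩ hq.1 hqR
  refine ⟨(e * q).re, ?_, ?_⟩
  · intro hd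
    exact hq.2 (neBot_of_diff hΩ.isOpen hen heE hφ.continuous hRΩ hq.1 hqR hd hκ)
  · simp only [Γ]
    rw [← hg, re_add_im]
    linear_combination q * heE

lemma isOpen_ntCone_vertex (S B : Set ℂ) (κ : ℝ) (z : ℂ) : IsOpen {q | z ∈ ntCone S B κ q} := by
  by_cases hz : z ∈ S
  · have : {q | z ∈ ntCone S B κ q} = {q | dist z q < κ * infDist z B} := by
      ext q; exact and_iff_right hz
    rw [this]
    exact isOpen_lt (by fun_prop) continuous_const
  · have : {q | z ∈ ntCone S B κ q} = ∅ := by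
      ext q; exact iff_of_false (fun h => hz h.1) (fun h => h)
    rw [this]; exact isOpen_empty

lemma aemeasurable_ntlim {S B : Set ℂ} {κ : ℝ} {σ : Measure ℂ} {a b : ℂ → ℝ}
    (hne : ∀ᵐ q ∂σ, (𝓝[ntCone S B κ q] q).NeBot)
    (hlim : ∀ᵐ q ∂σ, Tendsto a (𝓝[ntCone S B κ q] q) (𝓝 (b q))) : AEMeasurable b σ := by
  let T : ℕ → ℂ → Set ℂ := fun n q => ball q (1 / ((n : ℝ) + 1)) ∩ ntCone S B κ q
  have hT : ∀ n z, IsOpen {q | z ∈ T n q} := by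
    intro n z
    have : {q | z ∈ T n q} = {q | dist z q < 1 / ((n : ℝ) + 1)} ∩ {q | z ∈ ntCone S B κ q} := rfl
    rw [this]
    exact (isOpen_lt (by fun_prop) continuous_const).inter (isOpen_ntCone_vertex S B κ z)
  refine ⟨fun q => (⨅ n : ℕ, ⨆ z ∈ T n q, ((a z : ℝ) : EReal)).toReal, ?_, ?_⟩
  · refine measurable_ereal_toReal.comp (Measurable.iInf fun n => ?_)
    exact (lsc_sup (T n) (hT n) (fun z => ((a z : ℝ) : EReal))).measurable
  · filter_upwards [hne, hlim] with q hq1 hq2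
    have h1 : Tendsto (fun z => ((a z : ℝ) : EReal)) (𝓝[ntCone S B κ q] q) (𝓝 ((b q : ℝ) : EReal)) :=
      (continuous_coe_real_ereal.tendsto _).comp hq2
    have h2 := h1.limsup_eq
    have hb : (𝓝[ntCone S B κ q] q).HasBasis (fun _ : ℕ => True) (fun n => T n q) :=
      nhdsWithin_hasBasis nhds_basis_ball_inv_nat_succ _
    rw [hb.limsup_eq_iInf_iSup] at h2
    simp only [iInf_true] at h2
    rw [h2, EReal.toReal_coe]

lemma measurable_ntMax (S B : Set ℂ) (κ : ℝ) (f : ℂ → ℂ) : Measurable (ntMax S B κ f) :=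
  (lsc_sup (fun q => ntCone S B κ q) (isOpen_ntCone_vertex S B κ)
    (fun z => (‖f z‖₊ : ℝ≥0∞))).measurable

lemma lintegral_ntMax {S B : Set ℂ} {κ p : ℝ} {f : ℂ → ℂ} (hp : 1 ≤ p)
    (hfin : μH[1] B ≠ ⊤) (hM : MaximalInLp S B κ p f) :
    ∫⁻ q, ntMax S B κ f q ∂((μH[1]).restrict B) ≠ ⊤ := by
  have hle : ∫⁻ q, ntMax S B κ f q ∂((μH[1]).restrict B) ≤
      ∫⁻ q, (1 + (ntMax S B κ f q) ^ p) ∂((μH[1]).restrict B) := by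
    apply lintegral_mono
    intro q
    show ntMax S B κ f q ≤ 1 + (ntMax S B κ f q) ^ p
    by_cases h1 : ntMax S B κ f q ≤ 1
    · exact h1.trans le_self_add
    · refine le_trans ?_ le_add_self
      have := ENNReal.rpow_le_rpow_of_exponent_le (not_le.1 h1).le hp
      rwa [ENNReal.rpow_one] at this
  refine ne_top_of_le_ne_top ?_ hle
  rw [lintegral_add_left measurable_const]
  refine ENNReal.add_ne_top.2 ⟨?_, hM.ne⟩
  simpa using hfin

lemma integrable_ntlim {S B : Set ℂ} {κ p : ℝ} {f h : ℂ → ℂ} (hp : 1 ≤ p)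
    (hfin : μH[1] B ≠ ⊤) (hM : MaximalInLp S B κ p f)
    (hne : ∀ᵐ q ∂((μH[1]).restrict B), (𝓝[ntCone S B κ q] q).NeBot)
    (hlim : NTBdryValue S B κ f h) : Integrable h ((μH[1]).restrict B) := by
  have hmeas : AEMeasurable h ((μH[1]).restrict B) := by
    have h1 : AEMeasurable (fun q => (h q).re) ((μH[1]).restrict B) := by
      refine aemeasurable_ntlim (a := fun z => (f z).re) hne ?_
      filter_upwards [hlim] with q hq using (continuous_re.tendsto _).comp hq
    have h2 : AEMeasurable (fun q => (h q).im) ((μH[1]).restrict B) := by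
      refine aemeasurable_ntlim (a := fun z => (f z).im) hne ?_
      filter_upwards [hlim] with q hq using (continuous_im.tendsto _).comp hq
    have h3 : AEMeasurable (fun q => ((h q).re : ℂ) + ((h q).im : ℂ) * I) ((μH[1]).restrict B) :=
      (measurable_ofReal.comp_aemeasurable h1).add
        ((measurable_ofReal.comp_aemeasurable h2).mul_const I)
    simpa only [re_add_im] using h3
  refine ⟨hmeas.aestronglyMeasurable, ?_⟩
  refine lt_of_le_of_lt ?_ (lintegral_ntMax hp hfin hM).lt_top
  apply lintegral_mono_ae
  filter_upwards [hne, hlim] with q hq1 hq2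
  refine le_of_tendsto hq2.enorm ?_
  filter_upwards [self_mem_nhdsWithin] with z hz
  exact le_iSup₂ (f := fun z (_ : z ∈ ntCone S B κ q) => (‖f z‖₊ : ℝ≥0∞)) z hz

lemma glue_zero {Ω : Set ℂ} {γ : ℝ → ℂ} (hΩ : LipschitzJordanDomain Ω γ)
    {p : ℝ} (hp : 1 ≤ p) {h H : ℂ → ℂ} (heq : h =ᵐ[bMeasure Ω] H)
    {f g : ℂ → ℂ} (hf : DifferentiableOn ℂ f Ω) {κ₁ κ₂ : ℝ} (hκ₁ : 1 < κ₁) (hκ₂ : 1 < κ₂)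
    (hfM : MaximalInLp Ω (frontier Ω) κ₁ p f) (hfl : NTBdryValue Ω (frontier Ω) κ₁ f h)
    (hg : DifferentiableOn ℂ g (closure Ω)ᶜ) (hg0 : Tendsto g (cocompact ℂ) (𝓝 0))
    (hgM : MaximalInLp ((closure Ω)ᶜ) (frontier Ω) κ₂ p g)
    (hgl : NTBdryValue ((closure Ω)ᶜ) (frontier Ω) κ₂ g H) :
    EqOn f 0 Ω ∧ EqOn g 0 (closure Ω)ᶜ := by
  classical
  have hBeq : frontier Ω = closure Ω \ Ω := hΩ.isOpen.frontier_eq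
  have hBcl : IsClosed (frontier Ω) := isClosed_frontier
  have hB : IsCompact (frontier Ω) :=
    hΩ.bounded.isCompact_closure.of_isClosed_subset hBcl frontier_subset_closure
  have hBne : (frontier Ω).Nonempty := by
    rw [← hΩ.image]; exact ⟨γ 0, 0, by simp, rfl⟩
  have hfin := jordan_finite hΩ
  have : IsFiniteMeasure ((μH[1]).restrict (frontier Ω)) := ⟨by simpa using hfin.lt_top⟩
  obtain ⟨c, hc, r0, hr0, hlow⟩ := jordan_lower hΩ
  let F : ℂ → ℂ := fun z => if z ∈ Ω then f z else g z
  have hFin : ∀ z ∈ Ω, F z = f z := fun z hz => if_pos hz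
  have hFout : ∀ z, z ∉ Ω → F z = g z := fun z hz => if_neg hz
  have hFout' : ∀ z ∈ (closure Ω)ᶜ, F z = g z := fun z hz => hFout z fun h => hz (subset_closure h)
  have hcompl : ∀ z, z ∉ frontier Ω → z ∈ Ω ∨ z ∈ (closure Ω)ᶜ := by
    intro z hz
    by_cases h1 : z ∈ Ω
    · exact Or.inl h1
    · right; intro h2; exact hz (by rw [hBeq]; exact ⟨h2, h1⟩)
  have hFd : DifferentiableOn ℂ F (frontier Ω)ᶜ := by
    intro z hz
    apply DifferentiableAt.differentiableWithinAt
    rcases hcompl z hz with h1 | h1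
    · have h2 := hΩ.isOpen.mem_nhds h1
      exact (hf.differentiableAt h2).congr_of_eventuallyEq (Filter.eventuallyEq_of_mem h2 hFin)
    · have h2 := isClosed_closure.isOpen_compl.mem_nhds h1
      exact (hg.differentiableAt h2).congr_of_eventuallyEq (Filter.eventuallyEq_of_mem h2 hFout')
  have hF0 : Tendsto F (cocompact ℂ) (𝓝 0) := by
    refine hg0.congr' ?_
    filter_upwards [hΩ.bounded.isCompact_closure.compl_mem_cocompact] with z hz
    exact (hFout' z hz).symm
  let κ := min κ₁ κ₂
  have hκ : 1 < κ := lt_min hκ₁ hκ₂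
  have hcone : ∀ q ∈ frontier Ω, ∀ z, dist z q < κ * infDist z (frontier Ω) →
      z ∈ ntCone Ω (frontier Ω) κ₁ q ∨ z ∈ ntCone ((closure Ω)ᶜ) (frontier Ω) κ₂ q := by
    intro q hq z hz
    have hz' : z ∉ frontier Ω := by
      intro h
      rw [infDist_zero_of_mem h, mul_zero] at hz
      exact absurd hz (not_lt.2 dist_nonneg)
    rcases hcompl z hz' with h1 | h1
    · left
      exact ⟨h1, hz.trans_le (mul_le_mul_of_nonneg_right (min_le_left _ _) infDist_nonneg)⟩
    · right
      exact ⟨h1, hz.trans_le (mul_le_mul_of_nonneg_right (min_le_right _ _) infDist_nonneg)⟩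
  have hσ : ∀ᵐ q ∂((μH[1]).restrict (frontier Ω)), q ∈ frontier Ω :=
    ae_restrict_mem hBcl.measurableSet
  have hN : ∫⁻ q, (⨆ z ∈ {z | dist z q < κ * infDist z (frontier Ω)}, ‖F z‖ₑ)
      ∂((μH[1]).restrict (frontier Ω)) ≠ ⊤ := by
    have hle : ∫⁻ q, (⨆ z ∈ {z | dist z q < κ * infDist z (frontier Ω)}, ‖F z‖ₑ)
        ∂((μH[1]).restrict (frontier Ω)) ≤
        ∫⁻ q, (ntMax Ω (frontier Ω) κ₁ f q + ntMax ((closure Ω)ᶜ) (frontier Ω) κ₂ g q)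
        ∂((μH[1]).restrict (frontier Ω)) := by
      apply lintegral_mono_ae
      filter_upwards [hσ] with q hq
      refine iSup₂_le fun z hz => ?_
      rcases hcone q hq z hz with h1 | h1
      · refine le_trans ?_ le_self_add
        rw [hFin z h1.1]
        exact le_iSup₂ (f := fun z (_ : z ∈ ntCone Ω (frontier Ω) κ₁ q) => (‖f z‖₊ : ℝ≥0∞)) z h1
      · refine le_trans ?_ le_add_self
        rw [hFout' z h1.1]
        exact le_iSup₂ (f := fun z (_ : z ∈ ntCone ((closure Ω)ᶜ) (frontier Ω) κ₂ q) =>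
          (‖g z‖₊ : ℝ≥0∞)) z h1
    refine ne_top_of_le_ne_top ?_ hle
    rw [lintegral_add_left (measurable_ntMax _ _ _ _)]
    exact ENNReal.add_ne_top.2 ⟨lintegral_ntMax hp hfin hfM, lintegral_ntMax hp hfin hgM⟩
  have hlim : ∀ᵐ q ∂((μH[1]).restrict (frontier Ω)),
      Tendsto F (𝓝[{z | dist z q < κ * infDist z (frontier Ω)}] q) (𝓝 (h q)) := by
    have heq' : ∀ᵐ q ∂((μH[1]).restrict (frontier Ω)), h q = H q := heq
    filter_upwards [hσ, hfl, hgl, heq'] with q hq h1 h2 h3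
    have hsub : {z | dist z q < κ * infDist z (frontier Ω)} ⊆
        ntCone Ω (frontier Ω) κ₁ q ∪ ntCone ((closure Ω)ᶜ) (frontier Ω) κ₂ q := fun z hz => hcone q hq z hz
    refine Tendsto.mono_left ?_ (nhdsWithin_mono _ hsub)
    rw [nhdsWithin_union]
    refine Tendsto.sup ?_ ?_
    · refine h1.congr' ?_
      filter_upwards [self_mem_nhdsWithin] with z hz using (hFin z hz.1).symm
    · rw [h3]
      refine h2.congr' ?_
      filter_upwards [self_mem_nhdsWithin] with z hz using (hFout' z hz.1).symm
  have hh : Integrable h ((μH[1]).restrict (frontier Ω)) :=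
    integrable_ntlim hp hfin hfM (ae_neBot hΩ hκ₁) hfl
  have key := core_eq_zero (frontier Ω) hB hBne (jordan_vol hΩ) _ hσ hc hr0 hκ hlow hFd hF0 hh hN hlim
  constructor
  · intro z hz
    rw [← hFin z hz]
    exact key z (by rw [hBeq]; exact fun h => h.2 hz)
  · intro z hz
    rw [← hFout' z hz]
    exact key z fun h => hz (frontier_subset_closure h)

/-- **Uniqueness lemma for the `h + H` decomposition.**  Let `Ω` be a bounded Jordan
domain with Lipschitz boundary and `1 ≤ p < ∞`.  If `h ∈ h^p(bΩ)` and `H ∈ h^p_-(bΩ)`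
agree a.e. on `bΩ` with respect to arc length, then both are zero a.e. on `bΩ`;
equivalently, any holomorphic function on `Ω` in the Hardy class with boundary values
`h`, and any holomorphic function on `ℂ ∖ Ω̄` in the exterior Hardy class with boundary
values `H`, are identically zero. -/
theorem hardy_uniqueness
    (Ω : Set ℂ) (γ : ℝ → ℂ) (hΩ : LipschitzJordanDomain Ω γ)
    (p : ℝ) (hp : 1 ≤ p) (h H : ℂ → ℂ)
    (hh : MemHp Ω p h) (hH : MemHpExt Ω p H)
    (heq : h =ᵐ[bMeasure Ω] H) :
    (h =ᵐ[bMeasure Ω] 0) ∧ (H =ᵐ[bMeasure Ω] 0) ∧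
    (∀ f : ℂ → ℂ, DifferentiableOn ℂ f Ω →
      (∃ κ > 1, MaximalInLp Ω (frontier Ω) κ p f ∧
        NTBdryValue Ω (frontier Ω) κ f h) →
      EqOn f 0 Ω) ∧
    (∀ g : ℂ → ℂ, DifferentiableOn ℂ g (closure Ω)ᶜ →
      Tendsto g (cocompact ℂ) (𝓝 0) →
      (∃ κ > 1, MaximalInLp ((closure Ω)ᶜ) (frontier Ω) κ p g ∧
        NTBdryValue ((closure Ω)ᶜ) (frontier Ω) κ g H) →
      EqOn g 0 ((closure Ω)ᶜ)) := by
  have hh' := hh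
  have hH' := hH
  obtain ⟨f0, hf0, κ₁, hκ₁, hf0M, hf0l⟩ := hh'
  obtain ⟨g0, hg0, hg00, κ₂, hκ₂, hg0M, hg0l⟩ := hH'
  have hz := glue_zero hΩ hp heq hf0 hκ₁ hκ₂ hf0M hf0l hg0 hg00 hg0M hg0l
  have hh0 : h =ᵐ[bMeasure Ω] 0 := by
    show ∀ᵐ q ∂((μH[1]).restrict (frontier Ω)), h q = 0
    filter_upwards [ae_neBot hΩ hκ₁, hf0l] with q hq1 hq2
    refine tendsto_nhds_unique hq2 (tendsto_const_nhds.congr' ?_)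
    filter_upwards [self_mem_nhdsWithin] with z hzc
    exact (hz.1 hzc.1).symm
  refine ⟨hh0, heq.symm.trans hh0, ?_, ?_⟩
  · rintro f hf ⟨κ, hκ, hM, hl⟩
    exact (glue_zero hΩ hp heq hf hκ hκ₂ hM hl hg0 hg00 hg0M hg0l).1
  · rintro g hg hgt ⟨κ, hκ, hM, hl⟩
    exact (glue_zero hΩ hp heq hf0 hκ₁ hκ hf0M hf0l hg hgt hM hl).2
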